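/- Let σ ∈ ℂ\{0}, let p, q ∈ C¹([0,ℓ];ℝ), a ∈ C²([0,ℓ];ℝ) with a(x) > 0 on [0,ℓ], and let b ∈ C³([0,ℓ];ℂ) be such that its set of zeros in [0,ℓ] is finite and every zero is of order at most one. Suppose u, ũ ∈ C^{1,2}([0,T]×[0,ℓ];ℂ) satisfy σ∂_t u = a(x)∂_x²u − p(x)u and σ∂_t ũ = a(x)∂_x²ũ − q(x)ũ for 0<t<T, 0<x<ℓ, together with the FINAL condition u(T,·) = ũ(T,·) = b on (0,ℓ), u(t,0) = ũ(t,0) for 0<t<T, and ∂_x u(t,0) = ∂_x ũ(t,0) = 0 for 0<t<T. Then p = q on [0,ℓ]. -/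

import Mathlib

open Set MeasureTheory intervalIntegral

noncomputable section

/-- `u` is of class `C^{1,2}` on `[0,T] × [0,ℓ]`, with `ut`, `ux`, `uxx` its
partial derivatives `∂ₜu`, `∂ₓu`, `∂ₓ²u`. -/
def IsC12 (T ℓ : ℝ) (u ut ux uxx : ℝ → ℝ → ℂ) : Prop :=
  (∀ t ∈ Icc (0:ℝ) T, ∀ x ∈ Icc (0:ℝ) ℓ,
      HasDerivWithinAt (fun s => u s x) (ut t x) (Icc 0 T) t ∧
      HasDerivWithinAt (fun y => u t y) (ux t x) (Icc 0 ℓ) x ∧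
      HasDerivWithinAt (fun y => ux t y) (uxx t x) (Icc 0 ℓ) x) ∧
  ContinuousOn (fun z : ℝ × ℝ => u z.1 z.2) (Icc 0 T ×ˢ Icc 0 ℓ) ∧
  ContinuousOn (fun z : ℝ × ℝ => ut z.1 z.2) (Icc 0 T ×ˢ Icc 0 ℓ) ∧
  ContinuousOn (fun z : ℝ × ℝ => ux z.1 z.2) (Icc 0 T ×ˢ Icc 0 ℓ) ∧
  ContinuousOn (fun z : ℝ × ℝ => uxx z.1 z.2) (Icc 0 T ×ˢ Icc 0 ℓ)

section

open Filter Topology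

theorem hasDerivAt_integral_variable_upper {g g' : ℝ → ℝ → ℂ}
    (hg : Continuous fun z : ℝ × ℝ => g z.1 z.2) (hg' : Continuous fun z : ℝ × ℝ => g' z.1 z.2)
    (h : ∀ x s, HasDerivAt (fun y => g y s) (g' x s) x) (x : ℝ) :
    HasDerivAt (fun y => ∫ s in (0 : ℝ)..y, g y s) (g x x + ∫ s in (0 : ℝ)..x, g' x s) x := by
  have hgs : ∀ y, Continuous (g y) := fun y => hg.comp (by fun_prop : Continuous fun s => (y, s))
  have hgs' : ∀ y, Continuous (g' y) := fun y => hg'.comp (by fun_prop : Continuous fun s => (y, s))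
  have h1 : ∀ v : ℝ × ℝ, HasDerivAt (fun y => ∫ s in (0 : ℝ)..v.2, g y s)
      (∫ s in (0 : ℝ)..v.2, g' v.1 s) v.1 := by
    intro v
    obtain ⟨C, hC⟩ := ((isCompact_closedBall v.1 1).prod
      (isCompact_uIcc (a := (0 : ℝ)) (b := v.2))).exists_bound_of_continuousOn hg'.continuousOn
    refine (hasDerivAt_integral_of_dominated_loc_of_deriv_le (F := g) (F' := g')
      (bound := fun _ => C) (Metric.closedBall_mem_nhds v.1 one_pos)
      (Eventually.of_forall fun y => (hgs y).aestronglyMeasurable)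
      ((hgs _).intervalIntegrable _ _) (hgs' _).aestronglyMeasurable
      (Eventually.of_forall fun s hs y hy => hC (y, s) ⟨hy, uIoc_subset_uIcc hs⟩)
      (by simp) (Eventually.of_forall fun s _ y _ => h y s)).2
  have h2 : ∀ v : ℝ × ℝ, HasDerivAt (fun a => ∫ s in (0 : ℝ)..a, g v.1 s) (g v.1 v.2) v.2 :=
    fun v => integral_hasDerivAt_right ((hgs _).intervalIntegrable _ _)
      ((hgs _).stronglyMeasurableAtFilter _ _) (hgs _).continuousAt
  have hc1 : Continuous fun v : ℝ × ℝ => ∫ s in (0 : ℝ)..v.2, g' v.1 s := by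
    exact intervalIntegral.continuous_parametric_intervalIntegral_of_continuous (μ := volume)
      (f := fun (v : ℝ × ℝ) s => g' v.1 s)
      (hg'.comp (by fun_prop : Continuous fun p : (ℝ × ℝ) × ℝ => (p.1.1, p.2))) continuous_snd
  have key := hasStrictFDerivAt_uncurry_coprod (𝕜 := ℝ) (u := (x, x))
    (f := fun y a => ∫ s in (0 : ℝ)..a, g y s)
    (f₁ := fun y a => ContinuousLinearMap.toSpanSingleton ℝ (∫ s in (0 : ℝ)..a, g' y s))
    (f₂ := fun y a => ContinuousLinearMap.toSpanSingleton ℝ (g y a))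
    (Eventually.of_forall fun v => (h1 v).hasFDerivAt)
    (Eventually.of_forall fun v => (h2 v).hasFDerivAt)
    (by
      refine Continuous.continuousAt ?_
      exact (ContinuousLinearMap.toSpanSingletonCLE (𝕜 := ℝ) (E := ℂ)).continuous.comp hc1)
    (by
      refine Continuous.continuousAt ?_
      exact (ContinuousLinearMap.toSpanSingletonCLE (𝕜 := ℝ) (E := ℂ)).continuous.comp hg)
  have := key.hasFDerivAt.comp_hasDerivAt (f := fun y : ℝ => (y, y)) x
    ((hasDerivAt_id x).prodMk (hasDerivAt_id x))
  refine HasDerivAt.congr_deriv this ?_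
  simp [Function.HasUncurry.uncurry, add_comm]

theorem eq_zero_of_norm_le_integral {E : Type*} [NormedAddCommGroup E] {f : ℝ → E}
    (hf : Continuous f) {a b M : ℝ} (hab : a < b)
    (h : ∀ x ∈ Ioo a b, ‖f x‖ ≤ M * ∫ s in a..x, ‖f s‖) : ∀ x ∈ Icc a b, f x = 0 := by
  have hd : ∀ x, HasDerivAt (fun x => ∫ s in a..x, ‖f s‖) ‖f x‖ x := fun x =>
    integral_hasDerivAt_right (hf.norm.intervalIntegrable _ _)
      (hf.norm.stronglyMeasurableAtFilter _ _) hf.norm.continuousAt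
  have hd2 : ∀ x, HasDerivAt (fun x => Real.exp (-M * x) * ∫ s in a..x, ‖f s‖)
      (Real.exp (-M * x) * (-M) * (∫ s in a..x, ‖f s‖) + Real.exp (-M * x) * ‖f x‖) x := by
    intro x
    have := (((hasDerivAt_id x).const_mul (-M)).exp).mul (hd x)
    refine this.congr_deriv ?_
    simp
  have hanti : AntitoneOn (fun x => Real.exp (-M * x) * ∫ s in a..x, ‖f s‖) (Icc a b) := by
    refine antitoneOn_of_deriv_nonpos (convex_Icc a b)
      (fun x _ => (hd2 x).continuousAt.continuousWithinAt)
      (fun x _ => (hd2 x).differentiableAt.differentiableWithinAt) fun x hx => ?_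
    rw [interior_Icc] at hx
    rw [(hd2 x).deriv]
    have := h x hx
    have := Real.exp_pos (-M * x)
    nlinarith
  have hzero : ∀ x ∈ Icc a b, (∫ s in a..x, ‖f s‖) ≤ 0 := by
    intro x hx
    have := hanti (left_mem_Icc.2 hab.le) hx hx.1
    simp only [integral_same, mul_zero] at this
    exact nonpos_of_mul_nonpos_right this (Real.exp_pos _)
  have hIoo : ∀ x ∈ Ioo a b, f x = 0 := by
    intro x hx
    have h0 : (∫ s in a..x, ‖f s‖) = 0 := le_antisymm (hzero x (Ioo_subset_Icc_self hx))
      (integral_nonneg hx.1.le fun _ _ => norm_nonneg _)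
    have := h x hx
    rw [h0, mul_zero] at this
    exact norm_le_zero_iff.1 this
  have hcl : closure (Ioo a b) ⊆ {x | f x = 0} :=
    closure_minimal hIoo (isClosed_eq hf continuous_const)
  rw [closure_Ioo hab.ne] at hcl
  exact fun x hx => hcl hx

theorem isUnit_one_sub_of_weight {K : Type*} [TopologicalSpace K] [CompactSpace K]
    (T : C(K, ℂ) →L[ℂ] C(K, ℂ)) (w : C(K, ℝ)) (hw : ∀ z, 0 < w z)
    (h : ∀ (v : C(K, ℂ)) (c : ℝ), (∀ z, ‖v z‖ ≤ c * w z) → ∀ z, ‖T v z‖ ≤ c / 2 * w z) :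
    IsUnit (1 - T) := by
  let w₁ : C(K, ℂ) := ⟨fun z => (w z : ℂ), by fun_prop⟩
  let w₂ : C(K, ℂ) := ⟨fun z => ((w z)⁻¹ : ℂ), by
    have : ∀ z, (w z : ℂ) ≠ 0 := fun z => by exact_mod_cast (hw z).ne'
    fun_prop (disch := assumption)⟩
  have h12 : w₁ * w₂ = 1 := by
    ext z
    have : (w z : ℂ) ≠ 0 := by exact_mod_cast (hw z).ne'
    simp [w₁, w₂, this]
  let W₁ := ContinuousLinearMap.mul ℂ C(K, ℂ) w₁
  let W₂ := ContinuousLinearMap.mul ℂ C(K, ℂ) w₂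
  have hW12 : W₁ * W₂ = 1 := by
    ext1 v
    simp [W₁, W₂, ← mul_assoc, h12]
  have hW21 : W₂ * W₁ = 1 := by
    ext1 v
    simp [W₁, W₂, ← mul_assoc, mul_comm w₂ w₁, h12]
  have hnorm : ‖W₂ * T * W₁‖ ≤ 1 / 2 := by
    refine ContinuousLinearMap.opNorm_le_bound _ (by norm_num) fun v => ?_
    refine (ContinuousMap.norm_le _ (by positivity)).2 fun z => ?_
    have := h (w₁ * v) ‖v‖ (fun z => by
      have h1 := v.norm_coe_le_norm z
      have h2 := hw z
      simp only [ContinuousMap.mul_apply, w₁, ContinuousMap.coe_mk, norm_mul, Complex.norm_real,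
        Real.norm_eq_abs, abs_of_pos h2]
      nlinarith) z
    have h2 := hw z
    simp only [mul_apply_eq_comp, W₁, W₂, ContinuousLinearMap.mul_apply',
      ContinuousMap.mul_apply, norm_mul, w₂, ContinuousMap.coe_mk, norm_inv, Complex.norm_real,
      Real.norm_eq_abs, abs_of_pos h2]
    rw [inv_mul_le_iff₀ h2]
    linarith
  have hu : IsUnit (1 - W₂ * T * W₁) :=
    isUnit_one_sub_of_norm_lt_one (hnorm.trans_lt (by norm_num))
  have hW₁ : IsUnit W₁ := ⟨⟨W₁, W₂, hW12, hW21⟩, rfl⟩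
  have hW₂ : IsUnit W₂ := ⟨⟨W₂, W₁, hW21, hW12⟩, rfl⟩
  have : 1 - T = W₁ * (1 - W₂ * T * W₁) * W₂ := by
    rw [mul_sub, sub_mul, mul_one, hW12]
    congr 1
    simp only [← mul_assoc, hW12, one_mul]
    rw [mul_assoc, hW12, mul_one]
  rw [this]
  exact (hW₁.mul hu).mul hW₂

/-- `κ` solves the Goursat problem `∂ξ∂η κ = P (ξ + η) κ` on `[0,Λ]²` with `κ ξ 0 = h` and
`∂η κ 0 η = P η`; `κη` is `∂η κ`, and `κ₀` is an extension of `κ` from the square. -/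
structure IsGoursatKernel (Λ : ℝ) (P : ℝ → ℂ) (h : ℂ) (κ κη κ₀ : ℝ → ℝ → ℂ) : Prop where
  cont : Continuous fun z : ℝ × ℝ => κ z.1 z.2
  cont_deriv : Continuous fun z : ℝ × ℝ => κη z.1 z.2
  cont_ext : Continuous fun z : ℝ × ℝ => κ₀ z.1 z.2
  hasDerivAt_right : ∀ ξ η, HasDerivAt (fun y => κ ξ y) (κη ξ η) η
  hasDerivAt_left : ∀ ξ η, HasDerivAt (fun y => κη y η) (P (ξ + η) * κ₀ ξ η) ξ
  right_zero : ∀ ξ, κ ξ 0 = h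
  left_zero : ∀ η, κη 0 η = P η
  ext_eq : ∀ ξ ∈ Icc 0 Λ, ∀ η ∈ Icc 0 Λ, κ₀ ξ η = κ ξ η

theorem continuous_double_primitive {F : ℝ → ℝ → ℂ} (hF : Continuous fun z : ℝ × ℝ => F z.1 z.2) :
    Continuous fun z : ℝ × ℝ => ∫ y in (0 : ℝ)..z.2, ∫ x in (0 : ℝ)..z.1, F x y := by
  have h1 : Continuous fun p : ℝ × ℝ => ∫ x in (0 : ℝ)..p.1, F x p.2 :=
    intervalIntegral.continuous_parametric_intervalIntegral_of_continuous (μ := volume)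
      (f := fun (v : ℝ × ℝ) s => F s v.2)
      (hF.comp (by fun_prop : Continuous fun p : (ℝ × ℝ) × ℝ => (p.2, p.1.2))) continuous_fst
  exact intervalIntegral.continuous_parametric_intervalIntegral_of_continuous (μ := volume)
      (f := fun (v : ℝ × ℝ) s => ∫ x in (0 : ℝ)..v.1, F x s)
      (h1.comp (by fun_prop : Continuous fun p : (ℝ × ℝ) × ℝ => (p.1.1, p.2))) continuous_snd

theorem norm_double_integral_exp_le {F : ℝ → ℝ → ℂ} {c k ξ η : ℝ} (hc : 0 ≤ c)
    (hk : 0 < k) (hξ : 0 ≤ ξ) (hη : 0 ≤ η)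
    (hF : ∀ x ∈ Icc 0 ξ, ∀ y ∈ Icc 0 η, ‖F x y‖ ≤ c * Real.exp (k * (x + y))) :
    ‖∫ y in (0 : ℝ)..η, ∫ x in (0 : ℝ)..ξ, F x y‖ ≤ c / k ^ 2 * Real.exp (k * (ξ + η)) := by
  have hint : ∀ r : ℝ, ∫ x in (0 : ℝ)..r, Real.exp (k * x) = (Real.exp (k * r) - 1) / k := by
    intro r
    rw [intervalIntegral.integral_comp_mul_left (fun x => Real.exp x) hk.ne', integral_exp]
    simp [div_eq_inv_mul]
  have hinner : ∀ y ∈ Icc 0 η, ‖∫ x in (0 : ℝ)..ξ, F x y‖ ≤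
      c / k * Real.exp (k * ξ) * Real.exp (k * y) := by
    intro y hy
    calc ‖∫ x in (0 : ℝ)..ξ, F x y‖ ≤ ∫ x in (0 : ℝ)..ξ, c * Real.exp (k * y) * Real.exp (k * x) := by
          refine intervalIntegral.norm_integral_le_of_norm_le hξ (Eventually.of_forall fun x hx => ?_)
            ((by fun_prop : Continuous _).intervalIntegrable _ _)
          refine (hF x ⟨hx.1.le, hx.2⟩ y hy).trans_eq ?_
          rw [mul_add, Real.exp_add]; ring
      _ = c * Real.exp (k * y) * ((Real.exp (k * ξ) - 1) / k) := by
          rw [intervalIntegral.integral_const_mul, hint]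
      _ ≤ c * Real.exp (k * y) * (Real.exp (k * ξ) / k) := by gcongr; linarith
      _ = _ := by ring
  calc ‖∫ y in (0 : ℝ)..η, ∫ x in (0 : ℝ)..ξ, F x y‖
      ≤ ∫ y in (0 : ℝ)..η, c / k * Real.exp (k * ξ) * Real.exp (k * y) :=
        intervalIntegral.norm_integral_le_of_norm_le hη (Eventually.of_forall fun y hy => hinner y ⟨hy.1.le, hy.2⟩)
          ((by fun_prop : Continuous _).intervalIntegrable _ _)
    _ = c / k * Real.exp (k * ξ) * ((Real.exp (k * η) - 1) / k) := by
        rw [intervalIntegral.integral_const_mul, hint]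
    _ ≤ c / k * Real.exp (k * ξ) * (Real.exp (k * η) / k) := by gcongr; linarith
    _ = _ := by rw [mul_add, Real.exp_add]; field_simp

theorem exists_isGoursatKernel {Λ : ℝ} (hΛ : 0 ≤ Λ) {P : ℝ → ℂ} (hP : Continuous P) (h : ℂ) :
    ∃ κ κη κ₀, IsGoursatKernel Λ P h κ κη κ₀ := by
  obtain ⟨M, hM⟩ := (isCompact_Icc (a := (0 : ℝ)) (b := 2 * Λ)).exists_bound_of_continuousOn
    hP.continuousOn
  have hM0 : 0 ≤ M := (norm_nonneg _).trans (hM 0 ⟨le_rfl, by linarith⟩)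
  let ext : C(Icc (0 : ℝ) Λ × Icc (0 : ℝ) Λ, ℂ) → ℝ → ℝ → ℂ := fun v ξ η => v (projIcc 0 Λ hΛ ξ, projIcc 0 Λ hΛ η)
  have hext : ∀ v, Continuous fun z : ℝ × ℝ => ext v z.1 z.2 := fun v => by
    have h1 : Continuous (projIcc 0 Λ hΛ) := continuous_projIcc
    exact v.continuous.comp ((h1.comp continuous_fst).prodMk (h1.comp continuous_snd))
  let F : C(Icc (0 : ℝ) Λ × Icc (0 : ℝ) Λ, ℂ) → ℝ → ℝ → ℂ := fun v ξ η => P (ξ + η) * ext v ξ η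
  have hF : ∀ v, Continuous fun z : ℝ × ℝ => F v z.1 z.2 := fun v => by
    exact (hP.comp (continuous_fst.add continuous_snd)).mul (hext v)
  have hFx : ∀ v y, Continuous fun x => F v x y := fun v y =>
    (hF v).comp (by fun_prop : Continuous fun x : ℝ => (x, y))
  have hprim : ∀ v, Continuous fun z : ℝ × ℝ => ∫ x in (0 : ℝ)..z.1, F v x z.2 := fun v =>
    intervalIntegral.continuous_parametric_intervalIntegral_of_continuous (μ := volume)
      (f := fun (v' : ℝ × ℝ) s => F v s v'.2)
      ((hF v).comp (by fun_prop : Continuous fun p : (ℝ × ℝ) × ℝ => (p.2, p.1.2))) continuous_fst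
  have hprimy : ∀ v ξ, Continuous fun y => ∫ x in (0 : ℝ)..ξ, F v x y := fun v ξ =>
    (hprim v).comp (by fun_prop : Continuous fun y : ℝ => (ξ, y))
  have hFle : ∀ v c k, 0 ≤ c → (∀ z : Icc (0 : ℝ) Λ × Icc (0 : ℝ) Λ, ‖v z‖ ≤ c * Real.exp (k * (z.1 + z.2))) →
      ∀ x ∈ Icc 0 Λ, ∀ y ∈ Icc 0 Λ, ‖F v x y‖ ≤ M * c * Real.exp (k * (x + y)) := by
    intro v c k hc hv x hx y hy
    have h1 := hv (⟨x, hx⟩, ⟨y, hy⟩)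
    have h2 := hM (x + y) ⟨add_nonneg hx.1 hy.1, by linarith [hx.2, hy.2]⟩
    simp only [F, ext, norm_mul, projIcc_of_mem hΛ hx, projIcc_of_mem hΛ hy]
    calc _ ≤ M * (c * Real.exp (k * (x + y))) := by gcongr
      _ = _ := by ring
  let T₀ : C(Icc (0 : ℝ) Λ × Icc (0 : ℝ) Λ, ℂ) → C(Icc (0 : ℝ) Λ × Icc (0 : ℝ) Λ, ℂ) := fun v =>
    ⟨fun z => ∫ y in (0 : ℝ)..z.2, ∫ x in (0 : ℝ)..z.1, F v x y,
      (continuous_double_primitive (hF v)).comp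
        ((continuous_subtype_val.comp continuous_fst).prodMk
          (continuous_subtype_val.comp continuous_snd))⟩
  have hT₀ : ∀ v c k, 0 ≤ c → 0 < k → (∀ z : Icc (0 : ℝ) Λ × Icc (0 : ℝ) Λ, ‖v z‖ ≤ c * Real.exp (k * (z.1 + z.2))) →
      ∀ z : Icc (0 : ℝ) Λ × Icc (0 : ℝ) Λ, ‖T₀ v z‖ ≤ M * c / k ^ 2 * Real.exp (k * (z.1 + z.2)) := by
    intro v c k hc hk hv z
    refine norm_double_integral_exp_le (by positivity) hk z.1.2.1 z.2.2.1 fun x hx y hy => ?_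
    exact hFle v c k hc hv x ⟨hx.1, hx.2.trans z.1.2.2⟩ y ⟨hy.1, hy.2.trans z.2.2.2⟩
  let T : C(Icc (0 : ℝ) Λ × Icc (0 : ℝ) Λ, ℂ) →L[ℂ] C(Icc (0 : ℝ) Λ × Icc (0 : ℝ) Λ, ℂ) := LinearMap.mkContinuous
    { toFun := T₀
      map_add' := fun u v => by
        ext z
        simp only [T₀, ContinuousMap.coe_mk, ContinuousMap.add_apply]
        rw [← intervalIntegral.integral_add ((hprimy u _).intervalIntegrable _ _)
          ((hprimy v _).intervalIntegrable _ _)]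
        congr 1; ext y
        rw [← intervalIntegral.integral_add ((hFx u _).intervalIntegrable _ _)
          ((hFx v _).intervalIntegrable _ _)]
        congr 1; ext x
        simp [F, ext, mul_add]
      map_smul' := fun c v => by
        ext z
        simp only [T₀, ContinuousMap.coe_mk, ContinuousMap.smul_apply, smul_eq_mul, RingHom.id_apply]
        rw [← intervalIntegral.integral_const_mul]
        congr 1; ext y
        rw [← intervalIntegral.integral_const_mul]
        congr 1; ext x
        simp only [F, ext, ContinuousMap.smul_apply, smul_eq_mul]
        ring } (M * Real.exp (2 * Λ)) fun v => by
      refine (ContinuousMap.norm_le _ (by positivity)).2 fun z => ?_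
      have := hT₀ v ‖v‖ 1 (norm_nonneg _) one_pos (fun z => by
        have h1 := v.norm_coe_le_norm z
        have : (1 : ℝ) ≤ Real.exp (1 * (z.1 + z.2)) :=
          Real.one_le_exp (by have := z.1.2.1; have := z.2.2.1; linarith)
        nlinarith [norm_nonneg v]) z
      refine this.trans ?_
      have h3 : Real.exp (1 * ((z.1 : ℝ) + z.2)) ≤ Real.exp (2 * Λ) :=
        Real.exp_le_exp.2 (by have := z.1.2.2; have := z.2.2.2; linarith)
      calc _ ≤ M * ‖v‖ / 1 ^ 2 * Real.exp (2 * Λ) := by gcongr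
        _ = _ := by ring
  have hunit : IsUnit (1 - T) := by
    refine isUnit_one_sub_of_weight T
      ⟨fun z => Real.exp ((1 + 2 * M) * (z.1 + z.2)), by fun_prop⟩ (fun z => Real.exp_pos _) ?_
    intro v c hv z
    have hc : 0 ≤ c := by
      have := (norm_nonneg _).trans (hv (⟨0, le_rfl, hΛ⟩, ⟨0, le_rfl, hΛ⟩))
      exact nonneg_of_mul_nonneg_left this (Real.exp_pos _)
    refine (hT₀ v c (1 + 2 * M) hc (by positivity) hv z).trans ?_
    refine mul_le_mul_of_nonneg_right ?_ (Real.exp_pos _).le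
    rw [div_le_div_iff₀ (by positivity) (by norm_num)]
    nlinarith [mul_nonneg hc hM0, mul_nonneg hc (sq_nonneg M)]
  let F₀ : C(Icc (0 : ℝ) Λ × Icc (0 : ℝ) Λ, ℂ) := ⟨fun z => h + ∫ y in (0 : ℝ)..z.2, P y, by
    have := intervalIntegral.continuous_primitive (μ := volume)
      (fun a b => hP.intervalIntegrable a b) 0
    fun_prop⟩
  obtain ⟨R, hR⟩ := hunit.exists_right_inv
  let v := R F₀
  have hv : ∀ z, v z = F₀ z + T v z := by
    intro z
    have := congrArg (fun A => (A F₀) z) hR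
    simp only [mul_apply_eq_comp, sub_apply, one_apply_eq_self, ContinuousMap.sub_apply] at this
    rw [← this]; simp [v]
  have hFy : ∀ ξ, Continuous fun y => P y + ∫ x in (0 : ℝ)..ξ, F v x y := fun ξ =>
    hP.add (hprimy v ξ)
  refine ⟨fun ξ η => h + ∫ y in (0 : ℝ)..η, (P y + ∫ x in (0 : ℝ)..ξ, F v x y),
    fun ξ η => P η + ∫ x in (0 : ℝ)..ξ, F v x η, ext v, ?_, ?_, hext v, ?_, ?_, ?_, ?_, ?_⟩
  · refine continuous_const.add ?_
    exact intervalIntegral.continuous_parametric_intervalIntegral_of_continuous (μ := volume)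
      (f := fun (v' : ℝ × ℝ) s => P s + ∫ x in (0 : ℝ)..v'.1, F v x s)
      ((hP.comp continuous_snd).add ((hprim v).comp
        (by fun_prop : Continuous fun p : (ℝ × ℝ) × ℝ => (p.1.1, p.2)))) continuous_snd
  · exact (hP.comp continuous_snd).add (hprim v)
  · intro ξ η
    exact (integral_hasDerivAt_right ((hFy ξ).intervalIntegrable _ _)
      ((hFy ξ).stronglyMeasurableAtFilter _ _) (hFy ξ).continuousAt).const_add _
  · intro ξ η
    exact (integral_hasDerivAt_right ((hFx v η).intervalIntegrable _ _)
      ((hFx v η).stronglyMeasurableAtFilter _ _) (hFx v η).continuousAt).const_add _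
  · simp
  · simp
  · intro ξ hξ η hη
    simp only [ext, projIcc_of_mem hΛ hξ, projIcc_of_mem hΛ hη]
    rw [hv, intervalIntegral.integral_add (hP.intervalIntegrable _ _)
      ((hprimy v ξ).intervalIntegrable _ _), ← add_assoc]
    rfl

/-- The extension of a function on `[0,Λ]` to an even function on `ℝ`, constant beyond `Λ`. -/
def evenExt {Λ : ℝ} (hΛ : 0 ≤ Λ) (B : C(Icc (0 : ℝ) Λ, ℂ)) (y : ℝ) : ℂ := B (projIcc 0 Λ hΛ |y|)

theorem continuous_evenExt {Λ : ℝ} (hΛ : 0 ≤ Λ) (B : C(Icc (0 : ℝ) Λ, ℂ)) :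
    Continuous (evenExt hΛ B) :=
  B.continuous.comp (continuous_projIcc.comp continuous_abs)

theorem evenExt_of_mem {Λ : ℝ} (hΛ : 0 ≤ Λ) (B : C(Icc (0 : ℝ) Λ, ℂ)) {y : ℝ}
    (hy : y ∈ Icc 0 Λ) : evenExt hΛ B y = B ⟨y, hy⟩ := by
  simp [evenExt, abs_of_nonneg hy.1, projIcc_of_mem hΛ hy]

theorem evenExt_neg {Λ : ℝ} (hΛ : 0 ≤ Λ) (B : C(Icc (0 : ℝ) Λ, ℂ)) (y : ℝ) :
    evenExt hΛ B (-y) = evenExt hΛ B y := by simp [evenExt]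

theorem norm_evenExt_le {Λ : ℝ} (hΛ : 0 ≤ Λ) (B : C(Icc (0 : ℝ) Λ, ℂ)) (y : ℝ) :
    ‖evenExt hΛ B y‖ ≤ ‖B‖ := B.norm_coe_le_norm _

theorem continuous_reflIntegrand {κ : ℝ → ℝ → ℂ} (hκ : Continuous fun z : ℝ × ℝ => κ z.1 z.2)
    {b : ℝ → ℂ} (hb : Continuous b) :
    Continuous fun z : ℝ × ℝ => κ z.2 (z.1 - z.2) * b (2 * z.2 - z.1) :=
  (hκ.comp (by fun_prop : Continuous fun z : ℝ × ℝ => (z.2, z.1 - z.2))).mul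
    (hb.comp (by fun_prop))

theorem continuous_reflIntegrand_right {κ : ℝ → ℝ → ℂ}
    (hκ : Continuous fun z : ℝ × ℝ => κ z.1 z.2) {b : ℝ → ℂ} (hb : Continuous b) (x : ℝ) :
    Continuous fun ξ => κ ξ (x - ξ) * b (2 * ξ - x) :=
  (continuous_reflIntegrand hκ hb).comp (by fun_prop : Continuous fun ξ : ℝ => (x, ξ))

/-- The Volterra operator `B ↦ (x ↦ ∫₀ˣ κ(ξ, x - ξ) B(2 * ξ - x) dξ)`, with `B` extended evenly. -/
def reflOp {Λ : ℝ} (hΛ : 0 ≤ Λ) (κ : ℝ → ℝ → ℂ) (hκ : Continuous fun z : ℝ × ℝ => κ z.1 z.2) :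
    C(Icc (0 : ℝ) Λ, ℂ) →ₗ[ℂ] C(Icc (0 : ℝ) Λ, ℂ) where
  toFun B := ⟨fun x => ∫ ξ in (0 : ℝ)..x, κ ξ (x - ξ) * evenExt hΛ B (2 * ξ - x),
    intervalIntegral.continuous_parametric_intervalIntegral_of_continuous (μ := volume)
      (f := fun (x : Icc (0 : ℝ) Λ) ξ => κ ξ (x - ξ) * evenExt hΛ B (2 * ξ - x))
      ((continuous_reflIntegrand hκ (continuous_evenExt hΛ B)).comp
        (by fun_prop : Continuous fun p : Icc (0 : ℝ) Λ × ℝ => ((p.1 : ℝ), p.2)))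
      continuous_subtype_val⟩
  map_add' u v := by
    ext x
    simp only [ContinuousMap.coe_mk, ContinuousMap.add_apply]
    rw [← intervalIntegral.integral_add
      ((continuous_reflIntegrand_right hκ (continuous_evenExt hΛ u) x).intervalIntegrable _ _)
      ((continuous_reflIntegrand_right hκ (continuous_evenExt hΛ v) x).intervalIntegrable _ _)]
    congr 1; ext ξ
    simp [evenExt, mul_add]
  map_smul' c v := by
    ext x
    simp only [ContinuousMap.coe_mk, ContinuousMap.smul_apply, smul_eq_mul, RingHom.id_apply]
    rw [← intervalIntegral.integral_const_mul]
    congr 1; ext ξ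
    simp only [evenExt, ContinuousMap.smul_apply, smul_eq_mul]
    ring

theorem reflOp_apply {Λ : ℝ} (hΛ : 0 ≤ Λ) {κ : ℝ → ℝ → ℂ}
    (hκ : Continuous fun z : ℝ × ℝ => κ z.1 z.2) (B : C(Icc (0 : ℝ) Λ, ℂ)) (x : Icc (0 : ℝ) Λ) :
    reflOp hΛ κ hκ B x = ∫ ξ in (0 : ℝ)..x, κ ξ (x - ξ) * evenExt hΛ B (2 * ξ - x) := rfl

theorem exists_inverse_reflOp {Λ : ℝ} (hΛ : 0 ≤ Λ) {κ : ℝ → ℝ → ℂ}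
    (hκ : Continuous fun z : ℝ × ℝ => κ z.1 z.2) :
    ∃ J : C(Icc (0 : ℝ) Λ, ℂ) →L[ℂ] C(Icc (0 : ℝ) Λ, ℂ),
      (∀ u, J u + reflOp hΛ κ hκ (J u) = u) ∧ ∀ B, J (B + reflOp hΛ κ hκ B) = B := by
  obtain ⟨M, hM⟩ := ((isCompact_Icc (a := (0 : ℝ)) (b := Λ)).prod
    (isCompact_Icc (a := (0 : ℝ)) (b := Λ))).exists_bound_of_continuousOn hκ.continuousOn
  have hM0 : 0 ≤ M := (norm_nonneg _).trans (hM (0, 0) ⟨⟨le_rfl, hΛ⟩, ⟨le_rfl, hΛ⟩⟩)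
  have hMx : ∀ x ∈ Icc 0 Λ, ∀ ξ ∈ Icc 0 x, ‖κ ξ (x - ξ)‖ ≤ M := fun x hx ξ hξ =>
    hM (ξ, x - ξ) ⟨⟨hξ.1, hξ.2.trans hx.2⟩, ⟨sub_nonneg.2 hξ.2, by linarith [hξ.1, hx.2]⟩⟩
  let L : C(Icc (0 : ℝ) Λ, ℂ) →L[ℂ] C(Icc (0 : ℝ) Λ, ℂ) :=
    (reflOp hΛ κ hκ).mkContinuous (M * Λ) fun B => by
      refine (ContinuousMap.norm_le _ (by positivity)).2 fun x => ?_
      rw [reflOp_apply]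
      have := intervalIntegral.norm_integral_le_of_norm_le_const (a := (0 : ℝ)) (b := x)
        (C := M * ‖B‖) (f := fun ξ => κ ξ (x - ξ) * evenExt hΛ B (2 * ξ - x)) fun ξ hξ => by
          rw [uIoc_of_le x.2.1] at hξ
          rw [norm_mul]
          have := hMx x x.2 ξ ⟨hξ.1.le, hξ.2⟩
          have := norm_evenExt_le hΛ B (2 * ξ - x)
          gcongr
      refine this.trans ?_
      rw [sub_zero, abs_of_nonneg x.2.1]
      have := x.2.2
      calc M * ‖B‖ * x ≤ M * ‖B‖ * Λ := by gcongr
        _ = _ := by ring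
  have hL : ∀ B, L B = reflOp hΛ κ hκ B := fun B => rfl
  have hk : (0 : ℝ) < 1 + 2 * M := by positivity
  have hunit : IsUnit (1 - (-L)) := by
    refine isUnit_one_sub_of_weight (-L) ⟨fun z => Real.exp ((1 + 2 * M) * z), by fun_prop⟩
      (fun z => Real.exp_pos _) ?_
    intro B c hB x
    have hc : 0 ≤ c := by
      have := (norm_nonneg _).trans (hB ⟨0, le_rfl, hΛ⟩)
      exact nonneg_of_mul_nonneg_left this (Real.exp_pos _)
    simp only [ContinuousMap.coe_mk] at hB ⊢
    rw [neg_apply, ContinuousMap.neg_apply, norm_neg, hL, reflOp_apply]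
    generalize hkM : 1 + 2 * M = k at *
    have h1 : ∀ ξ ∈ Ioc (0 : ℝ) x, ‖κ ξ (x - ξ) * evenExt hΛ B (2 * ξ - x)‖ ≤
        M * c * (Real.exp (k * (2 * ξ - x)) + Real.exp (k * (x - 2 * ξ))) := by
      intro ξ hξ
      have hξ' : |2 * ξ - x| ∈ Icc 0 Λ :=
        ⟨abs_nonneg _, by
          have := x.2.2
          rw [abs_le]; constructor <;> linarith [hξ.1, hξ.2]⟩
      have h2 : ‖evenExt hΛ B (2 * ξ - x)‖ ≤ c * Real.exp (k * |2 * ξ - x|) := by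
        rw [evenExt, projIcc_of_mem hΛ hξ']
        exact hB _
      have h3 : Real.exp (k * |2 * ξ - x|) ≤
          Real.exp (k * (2 * ξ - x)) + Real.exp (k * (x - 2 * ξ)) := by
        rcases abs_cases (2 * ξ - (x : ℝ)) with ⟨h, _⟩ | ⟨h, _⟩ <;> rw [h]
        · linarith [Real.exp_pos (k * (x - 2 * ξ))]
        · rw [neg_sub]; linarith [Real.exp_pos (k * (2 * ξ - x))]
      rw [norm_mul, mul_assoc]
      have := hMx x x.2 ξ ⟨hξ.1.le, hξ.2⟩
      gcongr
      exact h2.trans (by gcongr)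
    have hint : ∫ ξ in (0 : ℝ)..x, (Real.exp (k * (2 * ξ - x)) + Real.exp (k * (x - 2 * ξ))) =
        (Real.exp (k * x) - Real.exp (-(k * x))) / k := by
      have hd : ∀ ξ, HasDerivAt (fun ξ => (Real.exp (k * (2 * ξ - x)) -
          Real.exp (k * (x - 2 * ξ))) / (2 * k))
          (Real.exp (k * (2 * ξ - x)) + Real.exp (k * (x - 2 * ξ))) ξ := by
        intro ξ
        have h1 : HasDerivAt (fun ξ : ℝ => k * (2 * ξ - x)) (k * 2) ξ := by
          simpa using (((hasDerivAt_id ξ).const_mul 2).sub_const (x : ℝ)).const_mul k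
        have h2 : HasDerivAt (fun ξ : ℝ => k * (x - 2 * ξ)) (-(k * 2)) ξ := by
          simpa using (((hasDerivAt_id ξ).const_mul 2).const_sub (x : ℝ)).const_mul k
        refine ((h1.exp.sub h2.exp).div_const (2 * k)).congr_deriv ?_
        field_simp
        ring
      rw [intervalIntegral.integral_eq_sub_of_hasDerivAt (fun ξ _ => hd ξ)
        ((by fun_prop : Continuous _).intervalIntegrable _ _)]
      rw [show k * (2 * (x : ℝ) - x) = k * x by ring, show k * ((x : ℝ) - 2 * x) = -(k * x) by ring,
        show k * (2 * 0 - (x : ℝ)) = -(k * x) by ring, show k * ((x : ℝ) - 2 * 0) = k * x by ring]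
      field_simp
      ring
    calc _ ≤ ∫ ξ in (0 : ℝ)..x,
          M * c * (Real.exp (k * (2 * ξ - x)) + Real.exp (k * (x - 2 * ξ))) :=
          intervalIntegral.norm_integral_le_of_norm_le x.2.1
            (Eventually.of_forall h1) ((by fun_prop : Continuous _).intervalIntegrable _ _)
      _ = M * c * ((Real.exp (k * x) - Real.exp (-(k * x))) / k) := by
          rw [intervalIntegral.integral_const_mul, hint]
      _ ≤ M * c * (Real.exp (k * x) / k) := by
          gcongr
          linarith [Real.exp_pos (-(k * x))]
      _ = (M / k) * (c * Real.exp (k * x)) := by ring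
      _ ≤ 1 / 2 * (c * Real.exp (k * x)) := by
          refine mul_le_mul_of_nonneg_right ?_ (by positivity)
          rw [div_le_iff₀ hk]; linarith
      _ = _ := by ring
  obtain ⟨J, hJ⟩ := hunit
  refine ⟨(↑J⁻¹ : C(Icc (0 : ℝ) Λ, ℂ) →L[ℂ] C(Icc (0 : ℝ) Λ, ℂ)), fun u => ?_, fun B => ?_⟩
  · have := congrArg (fun A => A u) J.mul_inv
    rw [hJ] at this
    simpa [hL] using this
  · have := congrArg (fun A => A B) J.inv_mul
    rw [hJ] at this
    simpa [hL] using this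

theorem integral_reflect_eq {κ : ℝ → ℝ → ℂ} {b : ℝ → ℂ} (x : ℝ) :
    ∫ ξ in (0 : ℝ)..x, κ ξ (x - ξ) * b (2 * ξ - x) =
      ∫ η in (0 : ℝ)..x, κ (x - η) η * b (x - 2 * η) := by
  have := intervalIntegral.integral_comp_sub_left (a := (0 : ℝ)) (b := x)
    (fun ξ => κ ξ (x - ξ) * b (2 * ξ - x)) x
  rw [sub_zero, sub_self] at this
  rw [← this]
  congr 1; ext η
  rw [sub_sub_cancel, show 2 * (x - η) - x = x - 2 * η by ring]

namespace IsGoursatKernel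

variable {Λ : ℝ} {P : ℝ → ℂ} {h : ℂ} {κ κη κ₀ : ℝ → ℝ → ℂ}

theorem hasDerivAt_integral (hk : IsGoursatKernel Λ P h κ κη κ₀) {B B' : ℝ → ℂ}
    (hB' : Continuous B') (hB : ∀ x, HasDerivAt B (B' x) x) (x : ℝ) :
    HasDerivAt (fun x => ∫ ξ in (0 : ℝ)..x, κ ξ (x - ξ) * B (2 * ξ - x))
      (h * B x + ((∫ ξ in (0 : ℝ)..x, κη ξ (x - ξ) * B (2 * ξ - x)) -
        ∫ ξ in (0 : ℝ)..x, κ ξ (x - ξ) * B' (2 * ξ - x))) x := by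
  have hBc : Continuous B := continuous_iff_continuousAt.2 fun x => (hB x).continuousAt
  have := hasDerivAt_integral_variable_upper
    (g := fun y s => κ s (y - s) * B (2 * s - y))
    (g' := fun y s => κη s (y - s) * B (2 * s - y) - κ s (y - s) * B' (2 * s - y))
    (continuous_reflIntegrand hk.cont hBc)
    ((continuous_reflIntegrand hk.cont_deriv hBc).sub (continuous_reflIntegrand hk.cont hB'))
    (fun y s => by
      have h1 : HasDerivAt (fun y : ℝ => y - s) 1 y := (hasDerivAt_id y).sub_const s
      have h2 : HasDerivAt (fun y : ℝ => 2 * s - y) (-1) y := (hasDerivAt_id y).const_sub _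
      have h3 := (hk.hasDerivAt_right s (y - s)).scomp y h1
      have h4 := (hB (2 * s - y)).scomp y h2
      refine (h3.mul h4).congr_deriv ?_
      simp
      ring) x
  refine this.congr_deriv ?_
  rw [sub_self, hk.right_zero, show 2 * x - x = x by ring, intervalIntegral.integral_sub
    ((continuous_reflIntegrand_right hk.cont_deriv hBc x).intervalIntegrable _ _)
    ((continuous_reflIntegrand_right hk.cont hB' x).intervalIntegrable _ _)]

theorem hasDerivAt_integral_deriv (hk : IsGoursatKernel Λ P h κ κη κ₀) (hP : Continuous P)
    {B B' : ℝ → ℂ} (hB' : Continuous B') (hB : ∀ x, HasDerivAt B (B' x) x) (x : ℝ) :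
    HasDerivAt (fun x => ∫ ξ in (0 : ℝ)..x, κη ξ (x - ξ) * B (2 * ξ - x))
      (P x * B (-x) + (P x * (∫ ξ in (0 : ℝ)..x, κ₀ ξ (x - ξ) * B (2 * ξ - x)) +
        ∫ ξ in (0 : ℝ)..x, κη ξ (x - ξ) * B' (2 * ξ - x))) x := by
  have hBc : Continuous B := continuous_iff_continuousAt.2 fun x => (hB x).continuousAt
  have hd : Continuous fun z : ℝ × ℝ => (z.1 - z.2, z.2) := by fun_prop
  have hc : ∀ {b : ℝ → ℂ}, Continuous b → Continuous fun z : ℝ × ℝ => b (z.1 - 2 * z.2) :=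
    fun hb => hb.comp (by fun_prop)
  have hx : Continuous fun s : ℝ => (x, s) := by fun_prop
  have hκB : Continuous fun z : ℝ × ℝ => κ₀ (z.1 - z.2) z.2 * B (z.1 - 2 * z.2) :=
    (hk.cont_ext.comp hd).mul (hc hBc)
  have hκB' : Continuous fun z : ℝ × ℝ => κη (z.1 - z.2) z.2 * B' (z.1 - 2 * z.2) :=
    (hk.cont_deriv.comp hd).mul (hc hB')
  have := hasDerivAt_integral_variable_upper
    (g := fun y s => κη (y - s) s * B (y - 2 * s))
    (g' := fun y s => P y * (κ₀ (y - s) s * B (y - 2 * s)) + κη (y - s) s * B' (y - 2 * s))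
    ((hk.cont_deriv.comp hd).mul (hc hBc))
    (((hP.comp continuous_fst).mul hκB).add hκB')
    (fun y s => by
      have h1 : HasDerivAt (fun y : ℝ => y - s) 1 y := (hasDerivAt_id y).sub_const s
      have h2 : HasDerivAt (fun y : ℝ => y - 2 * s) 1 y := (hasDerivAt_id y).sub_const _
      have h3 := (hk.hasDerivAt_left (y - s) s).scomp y h1
      have h4 := (hB (y - 2 * s)).scomp y h2
      refine (h3.mul h4).congr_deriv ?_
      simp
      ring) x
  have h1 : Continuous fun s => P x * (κ₀ (x - s) s * B (x - 2 * s)) :=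
    continuous_const.mul (hκB.comp hx)
  have h2 : Continuous fun s => κη (x - s) s * B' (x - 2 * s) := hκB'.comp hx
  simp_rw [integral_reflect_eq]
  refine this.congr_deriv ?_
  rw [sub_self, hk.left_zero, show x - 2 * x = -x by ring, intervalIntegral.integral_add
    (h1.intervalIntegrable _ _) (h2.intervalIntegrable _ _), intervalIntegral.integral_const_mul]


theorem continuous_integral_refl {κ : ℝ → ℝ → ℂ} (hκ : Continuous fun z : ℝ × ℝ => κ z.1 z.2)
    {b : ℝ → ℂ} (hb : Continuous b) :
    Continuous fun x => ∫ ξ in (0 : ℝ)..x, κ ξ (x - ξ) * b (2 * ξ - x) :=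
  intervalIntegral.continuous_parametric_intervalIntegral_of_continuous (μ := volume)
    (f := fun x ξ => κ ξ (x - ξ) * b (2 * ξ - x)) (continuous_reflIntegrand hκ hb) continuous_id

theorem taylor_integral_of_hasDerivAt {c c₁ c₂ : ℝ → ℂ} (hc₂ : Continuous c₂)
    (hc : ∀ x, HasDerivAt c (c₁ x) x) (hc₁ : ∀ x, HasDerivAt c₁ (c₂ x) x) (x : ℝ) :
    c x = c 0 + x * c₁ 0 + ∫ s in (0 : ℝ)..x, ((x - s : ℝ) : ℂ) * c₂ s := by
  have hd : ∀ s, HasDerivAt (fun s => ((x - s : ℝ) : ℂ) * c₁ s + c s)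
      (((x - s : ℝ) : ℂ) * c₂ s) s := fun s => by
    have h1 : HasDerivAt (fun s : ℝ => x - s) (-1) s := (hasDerivAt_id s).const_sub _
    refine ((h1.ofReal_comp.mul (hc₁ s)).add (hc s)).congr_deriv ?_
    push_cast; ring
  rw [intervalIntegral.integral_eq_sub_of_hasDerivAt (fun s _ => hd s)
    (Continuous.intervalIntegrable (by fun_prop) _ _)]
  simp
  ring

theorem transmutation (hk : IsGoursatKernel Λ P h κ κη κ₀) (hP : Continuous P)
    {B B' G : ℝ → ℂ} (hG : Continuous G) (hB : ∀ x, HasDerivAt B (B' x) x)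
    (hB' : ∀ x, HasDerivAt B' (G x) x) (hB0 : B' 0 = 0) (heven : ∀ x, B (-x) = B x)
    {c : ℝ → ℂ} (hc : ∀ x, c x = B x + ∫ ξ in (0 : ℝ)..x, κ ξ (x - ξ) * B (2 * ξ - x))
    {x : ℝ} (hx : x ∈ Icc 0 Λ) :
    c x = B 0 * (1 + h * x) + ∫ s in (0 : ℝ)..x, ((x - s : ℝ) : ℂ) *
      (P s * c s + (G s + ∫ ξ in (0 : ℝ)..s, κ ξ (s - ξ) * G (2 * ξ - s))) := by
  have hBc : Continuous B := continuous_iff_continuousAt.2 fun x => (hB x).continuousAt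
  have hB'c : Continuous B' := continuous_iff_continuousAt.2 fun x => (hB' x).continuousAt
  obtain rfl : c = _ := funext hc
  have h1 := fun x => (hB x).add (hk.hasDerivAt_integral hB'c hB x)
  have h2 := fun x => (hB' x).add (((hB x).const_mul h).add
    ((hk.hasDerivAt_integral_deriv hP hB'c hB x).sub (hk.hasDerivAt_integral hG hB' x)))
  have hcont := hP.mul (continuous_integral_refl hk.cont_ext hBc)
  have hcont2 := continuous_integral_refl hk.cont hG
  have hcont3 := continuous_integral_refl hk.cont_deriv hB'c
  have ht := taylor_integral_of_hasDerivAt (hG.add ((continuous_const.mul hB'c).add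
    (((hP.mul (hBc.comp continuous_neg)).add (hcont.add hcont3)).sub
      ((continuous_const.mul hB'c).add (hcont3.sub hcont2))))) h1 h2 x
  refine ht.trans ?_
  simp only [Pi.add_apply, intervalIntegral.integral_same, hB0, add_zero, sub_self, zero_add]
  congr 1
  · ring
  · refine intervalIntegral.integral_congr fun s hs => ?_
    rw [uIcc_of_le hx.1] at hs
    have : ∫ ξ in (0 : ℝ)..s, κ₀ ξ (s - ξ) * B (2 * ξ - s) =
        ∫ ξ in (0 : ℝ)..s, κ ξ (s - ξ) * B (2 * ξ - s) := by
      refine intervalIntegral.integral_congr fun ξ hξ => ?_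
      rw [uIcc_of_le hs.1] at hξ
      have := hs.2.trans hx.2
      rw [hk.ext_eq ξ ⟨hξ.1, hξ.2.trans this⟩ (s - ξ) ⟨sub_nonneg.2 hξ.2, by linarith [hξ.1]⟩]
    simp only [Pi.add_apply, Pi.sub_apply, Pi.mul_apply, Function.comp_apply]
    rw [this, heven]
    ring

/-- The inverse of `1 + reflOp` turns solutions of `∂ₓ² u = P u + w`, `∂ₓ u 0 = h u 0` into
solutions of `∂ₓ² B = G`, `∂ₓ B 0 = 0`. -/
theorem inverse_apply_of_mild (hk : IsGoursatKernel Λ P h κ κη κ₀) (hP : Continuous P)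
    (hΛ : 0 < Λ) {J : C(Icc (0 : ℝ) Λ, ℂ) → C(Icc (0 : ℝ) Λ, ℂ)}
    (hJ₁ : ∀ u, J u + reflOp hΛ.le κ hk.cont (J u) = u)
    (hJ₂ : ∀ B, J (B + reflOp hΛ.le κ hk.cont B) = B) {u w : C(Icc (0 : ℝ) Λ, ℂ)} {β : ℂ}
    (hu : ∀ x : Icc (0 : ℝ) Λ, u x = β * (1 + h * (x : ℝ)) + ∫ s in (0 : ℝ)..x,
      (((x : ℝ) - s : ℝ) : ℂ) * (P s * evenExt hΛ.le u s + evenExt hΛ.le w s))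
    (x : Icc (0 : ℝ) Λ) :
    J u x = β + ∫ s in (0 : ℝ)..x, (((x : ℝ) - s : ℝ) : ℂ) * evenExt hΛ.le (J w) s := by
  set G := evenExt hΛ.le (J w) with hGdef
  have hG : Continuous G := continuous_evenExt _ _
  let B : ℝ → ℂ := fun y => β + ∫ s in (0 : ℝ)..y, ((y - s : ℝ) : ℂ) * G s
  let B' : ℝ → ℂ := fun y => ∫ s in (0 : ℝ)..y, G s
  have hB : ∀ y, HasDerivAt B (B' y) y := fun y => by
    have := hasDerivAt_integral_variable_upper (g := fun y s => ((y - s : ℝ) : ℂ) * G s)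
      (g' := fun _ s => G s) (by fun_prop) (by fun_prop) (fun y s => by
        have h1 : HasDerivAt (fun y : ℝ => y - s) 1 y := (hasDerivAt_id y).sub_const _
        simpa using h1.ofReal_comp.mul_const (G s)) y
    exact (this.const_add β).congr_deriv (by simp [B'])
  have hB' : ∀ y, HasDerivAt B' (G y) y := fun y =>
    intervalIntegral.integral_hasDerivAt_right (hG.intervalIntegrable _ _)
      (hG.stronglyMeasurableAtFilter _ _) hG.continuousAt
  have hBc : Continuous B := continuous_iff_continuousAt.2 fun x => (hB x).continuousAt
  have heven : ∀ y, B (-y) = B y := fun y => by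
    simp only [B]
    congr 1
    have := intervalIntegral.integral_comp_neg (a := (0 : ℝ)) (b := y)
      (fun s => ((-y - s : ℝ) : ℂ) * G s)
    rw [neg_zero, intervalIntegral.integral_symm 0 (-y)] at this
    rw [← neg_eq_iff_eq_neg.2 this, ← intervalIntegral.integral_neg]
    congr 1; ext s
    rw [hGdef, evenExt_neg]; push_cast; ring
  let Bm : C(Icc (0 : ℝ) Λ, ℂ) := ⟨fun y => B y, hBc.comp continuous_subtype_val⟩
  have hBm : ∀ y, |y| ≤ Λ → evenExt hΛ.le Bm y = B y := fun y hy => by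
    rw [evenExt, projIcc_of_mem hΛ.le ⟨abs_nonneg y, hy⟩]
    change B |y| = B y
    rcases abs_choice y with h | h <;> rw [h]
    exact heven y
  let c : ℝ → ℂ := fun x => B x + ∫ ξ in (0 : ℝ)..x, κ ξ (x - ξ) * B (2 * ξ - x)
  have hcc : Continuous c := hBc.add (continuous_integral_refl hk.cont hBc)
  have hcm : ∀ x : Icc (0 : ℝ) Λ, (Bm + reflOp hΛ.le κ hk.cont Bm) x = c x := fun x => by
    simp only [ContinuousMap.add_apply, reflOp_apply, c]
    congr 1
    refine intervalIntegral.integral_congr fun ξ hξ => ?_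
    rw [uIcc_of_le x.2.1] at hξ
    have := x.2.2
    rw [hBm _ (abs_le.2 ⟨by linarith [hξ.1], by linarith [hξ.2]⟩)]
  have hce := fun x hx => hk.transmutation hP hG hB hB' (by simp [B']) heven (c := c)
    (fun _ => rfl) (x := x) hx
  have hGw : ∀ s ∈ Icc 0 Λ, G s + ∫ ξ in (0 : ℝ)..s, κ ξ (s - ξ) * G (2 * ξ - s) =
      evenExt hΛ.le w s := fun s hs => by
    have := congrArg (fun f => f ⟨s, hs⟩) (hJ₁ w)
    simp only [ContinuousMap.add_apply, reflOp_apply] at this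
    rw [evenExt_of_mem _ w hs, ← this, hGdef, evenExt_of_mem _ (J w) hs]
  have hB0 : B 0 = β := by simp [B]
  suffices hcu : ∀ x ∈ Icc 0 Λ, c x - evenExt hΛ.le u x = 0 by
    have : u = Bm + reflOp hΛ.le κ hk.cont Bm := by
      ext y
      rw [hcm, sub_eq_zero.1 (hcu y y.2), evenExt_of_mem _ _ y.2]
    rw [this, hJ₂]
    rfl
  obtain ⟨M, hM⟩ := (isCompact_Icc (a := (0 : ℝ)) (b := Λ)).exists_bound_of_continuousOn
    hP.continuousOn
  have hue := continuous_evenExt hΛ.le u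
  have hwe := continuous_evenExt hΛ.le w
  refine eq_zero_of_norm_le_integral (f := fun x => c x - evenExt hΛ.le u x)
    (hcc.sub (continuous_evenExt _ _)) hΛ (M := Λ * M) fun x hx => ?_
  have hxI : x ∈ Icc 0 Λ := ⟨hx.1.le, hx.2.le⟩
  have heq : c x - evenExt hΛ.le u x = ∫ s in (0 : ℝ)..x, ((x - s : ℝ) : ℂ) *
      (P s * (c s - evenExt hΛ.le u s)) := by
    rw [evenExt_of_mem _ u hxI, hu ⟨x, hxI⟩, hce x hxI, hB0, add_sub_add_left_eq_sub]
    rw [intervalIntegral.integral_congr (g := fun s => ((x - s : ℝ) : ℂ) *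
      (P s * c s + evenExt hΛ.le w s)) fun s hs => by
        rw [uIcc_of_le hx.1.le] at hs
        simp only
        rw [hGw s ⟨hs.1, hs.2.trans hx.2.le⟩]]
    rw [← intervalIntegral.integral_sub (Continuous.intervalIntegrable (by fun_prop) _ _)
      (Continuous.intervalIntegrable (by fun_prop) _ _)]
    congr 1; ext s; ring
  rw [heq, ← intervalIntegral.integral_const_mul]
  refine intervalIntegral.norm_integral_le_of_norm_le hx.1.le (Eventually.of_forall fun s hs => ?_)
    (Continuous.intervalIntegrable (by fun_prop) _ _)
  rw [norm_mul, norm_mul, ← mul_assoc]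
  refine mul_le_mul_of_nonneg_right ?_ (norm_nonneg _)
  refine mul_le_mul ?_ (hM s ⟨hs.1.le, hs.2.trans hx.2.le⟩) (norm_nonneg _) hΛ.le
  rw [Complex.norm_real, Real.norm_eq_abs, abs_of_nonneg (by linarith [hs.2])]
  linarith [hs.1, hx.2]

end IsGoursatKernel

theorem hasDerivAt_laplace {z : ℝ → ℂ} (hz : Continuous z) (X : ℝ) (k : ℂ) :
    HasDerivAt (fun k : ℂ => ∫ y in (0 : ℝ)..X, Complex.exp (k * (X - y)) * z y)
      (∫ y in (0 : ℝ)..X, Complex.exp (k * (X - y)) * ((X - y) * z y)) k := by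
  have hcont : Continuous fun w : ℂ × ℝ => Complex.exp (w.1 * (X - w.2)) * ((X - w.2) * z w.2) := by
    fun_prop
  obtain ⟨C, hC⟩ := ((isCompact_closedBall k 1).prod (isCompact_uIcc (a := (0 : ℝ)) (b := X))
    ).exists_bound_of_continuousOn hcont.continuousOn
  refine (intervalIntegral.hasDerivAt_integral_of_dominated_loc_of_deriv_le (μ := volume)
    (F := fun (k : ℂ) (y : ℝ) => Complex.exp (k * (X - y)) * z y)
    (F' := fun (k : ℂ) (y : ℝ) => Complex.exp (k * (X - y)) * ((X - y) * z y))
    (bound := fun _ => C) (s := Metric.ball k 1) (Metric.ball_mem_nhds k one_pos)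
    (Eventually.of_forall fun k => Continuous.aestronglyMeasurable (by fun_prop))
    (Continuous.intervalIntegrable (by fun_prop) _ _)
    (Continuous.aestronglyMeasurable (by fun_prop))
    (Eventually.of_forall fun y hy w hw =>
      hC (w, y) ⟨Metric.ball_subset_closedBall hw, uIoc_subset_uIcc hy⟩)
    (continuous_const.intervalIntegrable _ _)
    (Eventually.of_forall fun y hy w hw => ?_)).2
  have h1 : HasDerivAt (fun k : ℂ => k * (X - y)) (X - y) w := by
    simpa using (hasDerivAt_id w).mul_const ((X : ℂ) - y)
  exact (h1.cexp.mul_const (z y)).congr_deriv (by ring)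

theorem norm_laplace_le {z : ℝ → ℂ} (hz : Continuous z) {X : ℝ} (hX : 0 ≤ X) {k : ℂ} {r : ℝ}
    (hr : 0 ≤ r) (hk : k.re ≤ r) :
    ‖∫ y in (0 : ℝ)..X, Complex.exp (k * (X - y)) * z y‖ ≤
      Real.exp (r * X) * ∫ y in (0 : ℝ)..X, ‖z y‖ := by
  rw [← intervalIntegral.integral_const_mul]
  refine intervalIntegral.norm_integral_le_of_norm_le hX (Eventually.of_forall fun y hy => ?_)
    (Continuous.intervalIntegrable (by fun_prop) _ _)
  rw [norm_mul, Complex.norm_exp]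
  refine mul_le_mul_of_nonneg_right (Real.exp_le_exp.2 ?_) (norm_nonneg _)
  rw [← Complex.ofReal_sub, Complex.re_mul_ofReal]
  have h1 : 0 ≤ X - y := sub_nonneg.2 hy.2
  calc k.re * (X - y) ≤ r * (X - y) := by gcongr
    _ ≤ r * X := by gcongr; linarith [hy.1]

theorem eq_zero_of_laplace_eq_zero {z : ℝ → ℂ} (hz : Continuous z) {X : ℝ}
    (h : ∀ k : ℂ, ∫ y in (0 : ℝ)..X, Complex.exp (k * (X - y)) * z y = 0) :
    ∀ x ∈ Ioo 0 X, z x = 0 := by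
  intro x hx
  have hX : 0 < X := hx.1.trans hx.2
  set f : ℝ → ℂ := indicator (Ioc 0 X) z with hf
  have hint : Integrable f :=
    (integrable_indicator_iff measurableSet_Ioc).2
      ((hz.integrableOn_Icc (a := 0) (b := X)).mono_set Ioc_subset_Icc_self)
  have hF : FourierTransform.fourier f = 0 := by
    ext ξ
    rw [Real.fourier_real_eq_integral_exp_smul]
    have h1 := h (2 * Real.pi * ξ * Complex.I)
    have h2 : (fun v : ℝ => Complex.exp (↑(-2 * Real.pi * v * ξ) * Complex.I) • f v) =
        indicator (Ioc 0 X) fun v => Complex.exp (-(2 * Real.pi * ξ * Complex.I) * X) *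
          (Complex.exp ((2 * Real.pi * ξ * Complex.I) * (X - v)) * z v) := by
      ext v
      by_cases hv : v ∈ Ioc 0 X
      · rw [hf, indicator_of_mem hv, indicator_of_mem hv, smul_eq_mul, ← mul_assoc, ← Complex.exp_add]
        congr 2; push_cast; ring
      · simp [hf, hv]
    rw [h2, MeasureTheory.integral_indicator measurableSet_Ioc, ← intervalIntegral.integral_of_le hX.le,
      intervalIntegral.integral_const_mul, h1, mul_zero]
    rfl
  have hx' : f =ᶠ[𝓝 x] z := by
    filter_upwards [Ioo_mem_nhds hx.1 hx.2] with y hy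
    exact indicator_of_mem (show y ∈ Ioc 0 X from ⟨hy.1, hy.2.le⟩) z
  have := hint.fourierInv_fourier_eq (v := x) (by rw [hF]; exact integrable_zero _ _ _)
    (hz.continuousAt.congr hx'.symm)
  rw [hF, hx'.eq_of_nhds] at this
  rw [← this, Real.fourierInv_eq]
  simp

/-- A Phragmén–Lindelöf estimate on a sector of opening less than `π`. -/
theorem bounded_of_sector {F : ℂ → ℂ} (hF : Differentiable ℂ F) {A D C : ℝ}
    (hgrowth : ∀ k, ‖F k‖ ≤ A * Real.exp (D * ‖k‖)) {α β : ℝ} (hαβ : α < β) (hβ : β - α < Real.pi)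
    (hα : ∀ k : ℂ, k ≠ 0 → k.arg = α → ‖F k‖ ≤ C) (hβ' : ∀ k : ℂ, k ≠ 0 → k.arg = β → ‖F k‖ ≤ C)
    (hrange : -Real.pi < α ∧ β ≤ Real.pi) {k : ℂ} (hk : k ≠ 0) (hk1 : α ≤ k.arg) (hk2 : k.arg ≤ β) :
    ‖F k‖ ≤ C := by
  have harg : ∀ w : ℂ, w.im ∈ Ioc (-Real.pi) Real.pi → (Complex.exp w).arg = w.im := by
    intro w hw
    rw [Complex.arg_exp, toIocMod_eq_self]
    exact ⟨hw.1, by linarith [hw.2]⟩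
  have := PhragmenLindelof.horizontal_strip (f := fun w => F (Complex.exp w)) (a := α) (b := β)
    (C := C) (z := Complex.log k) (hF.comp Complex.differentiable_exp).diffContOnCl ?_ ?_ ?_
    (by rwa [Complex.log_im]) (by rwa [Complex.log_im])
  · rwa [Complex.exp_log hk] at this
  · refine ⟨1, (one_lt_div (sub_pos.2 hαβ)).2 hβ, |D|, Asymptotics.IsBigO.of_bound |A|
      (Eventually.of_forall fun w => ?_)⟩
    rw [Real.norm_eq_abs, Real.abs_exp]
    refine (hgrowth _).trans ?_
    rw [Complex.norm_exp, one_mul]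
    refine mul_le_mul (le_abs_self A) (Real.exp_le_exp.2 ?_) (Real.exp_pos _).le (abs_nonneg _)
    exact mul_le_mul (le_abs_self D) (Real.exp_le_exp.2 (le_abs_self _)) (Real.exp_pos _).le
      (abs_nonneg _)
  · intro w hw
    exact hα _ (Complex.exp_ne_zero _) ((harg w ⟨by linarith, by linarith⟩).trans hw)
  · intro w hw
    exact hβ' _ (Complex.exp_ne_zero _) ((harg w ⟨by linarith, by linarith⟩).trans hw)

theorem eq_zero_of_laplace_bounded_on_ray {z : ℝ → ℂ} (hz : Continuous z) {X : ℝ} {ω : ℂ}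
    (hω : 0 < ω.re) {C : ℝ}
    (hray : ∀ r : ℝ, 0 < r →
      ‖∫ y in (0 : ℝ)..X, Complex.exp (r * ω * (X - y)) * z y‖ ≤ C) :
    ∀ x ∈ Ioo 0 X, z x = 0 := by
  intro x hx
  have hX : 0 < X := hx.1.trans hx.2
  set F : ℂ → ℂ := fun k => ∫ y in (0 : ℝ)..X, Complex.exp (k * (X - y)) * z y with hFdef
  set A := ∫ y in (0 : ℝ)..X, ‖z y‖ with hA
  have hA0 : 0 ≤ A := intervalIntegral.integral_nonneg hX.le fun _ _ => norm_nonneg _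
  have hFd : Differentiable ℂ F := fun k => (hasDerivAt_laplace hz X k).differentiableAt
  have hgrowth : ∀ k, ‖F k‖ ≤ A * Real.exp (X * ‖k‖) := fun k => by
    rw [mul_comm A, mul_comm X]
    exact norm_laplace_le hz hX.le (norm_nonneg k) (Complex.re_le_norm k)
  have hleft : ∀ k : ℂ, k.re ≤ 0 → ‖F k‖ ≤ max A C := fun k hk => by
    have := norm_laplace_le hz hX.le le_rfl hk
    rw [zero_mul, Real.exp_zero, one_mul] at this
    exact this.trans (le_max_left _ _)
  have hω0 : ω ≠ 0 := by rintro rfl; simp at hω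
  have hωn : 0 < ‖ω‖ := norm_pos_iff.2 hω0
  have hωarg := Complex.abs_arg_lt_pi_div_two_iff.2 (Or.inl hω)
  rw [abs_lt] at hωarg
  have hmid : ∀ k : ℂ, k ≠ 0 → k.arg = ω.arg → ‖F k‖ ≤ max A C := by
    intro k hk hkω
    have hkn : 0 < ‖k‖ := norm_pos_iff.2 hk
    have := hray (‖k‖ / ‖ω‖) (by positivity)
    have h2 : ((‖k‖ / ‖ω‖ : ℝ) : ℂ) * ω = k := by
      have := (Complex.arg_eq_arg_iff hω0 hk).1 hkω.symm
      rw [Complex.ofReal_div]; exact this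
    rw [h2] at this
    exact this.trans (le_max_right _ _)
  have hpi := Real.pi_pos
  have hbdd : ∀ k, ‖F k‖ ≤ max A C := by
    intro k
    rcases le_or_gt k.re 0 with hk | hk
    · exact hleft k hk
    have hk0 : k ≠ 0 := by rintro rfl; simp at hk
    have hkarg := Complex.abs_arg_lt_pi_div_two_iff.2 (Or.inl hk)
    rw [abs_lt] at hkarg
    rcases le_total k.arg ω.arg with h | h
    · refine bounded_of_sector hFd hgrowth (α := -(Real.pi / 2)) (β := ω.arg) (by linarith)
        (by linarith) (fun k hk0 hk => hleft k ?_) hmid ⟨by linarith, by linarith⟩ hk0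
        (by linarith) h
      by_contra hcon
      have := Complex.abs_arg_lt_pi_div_two_iff.2 (Or.inl (not_le.1 hcon))
      rw [abs_lt] at this
      linarith
    · refine bounded_of_sector hFd hgrowth (α := ω.arg) (β := Real.pi / 2) (by linarith)
        (by linarith) hmid (fun k hk0 hk => hleft k ?_) ⟨by linarith, by linarith⟩ hk0
        h (by linarith)
      by_contra hcon
      have := Complex.abs_arg_lt_pi_div_two_iff.2 (Or.inl (not_le.1 hcon))
      rw [abs_lt] at this
      linarith
  have hconst : ∀ k, F k = F 0 := fun k =>
    hFd.apply_eq_apply_of_bounded (Metric.isBounded_iff_subset_closedBall 0 |>.2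
      ⟨max A C, by rintro _ ⟨k, rfl⟩; simpa using hbdd k⟩) k 0
  have hder : ∀ k : ℂ, ∫ y in (0 : ℝ)..X, Complex.exp (k * (X - y)) * ((X - y) * z y) = 0 := by
    intro k
    have h1 : HasDerivAt F 0 k := by
      rw [show F = fun _ => F 0 from funext hconst]
      exact hasDerivAt_const _ _
    exact (hasDerivAt_laplace hz X k).unique h1
  have := eq_zero_of_laplace_eq_zero (z := fun y : ℝ => ((X : ℂ) - y) * z y) (by fun_prop) hder x hx
  refine (mul_eq_zero.1 this).resolve_left ?_
  rw [← Complex.ofReal_sub]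
  exact_mod_cast (sub_pos.2 hx.2).ne'

/-- The functional `w ↦ ∫₀^Λ exp(k (Λ - y)) w y dy`. -/
def laplaceCLM {Λ : ℝ} (hΛ : 0 ≤ Λ) (k : ℂ) : C(Icc (0 : ℝ) Λ, ℂ) →L[ℂ] ℂ :=
  LinearMap.mkContinuous
    { toFun := fun w => ∫ y in (0 : ℝ)..Λ, Complex.exp (k * (Λ - y)) * evenExt hΛ w y
      map_add' := fun u v => by
        have := continuous_evenExt hΛ u
        have := continuous_evenExt hΛ v
        rw [← intervalIntegral.integral_add (Continuous.intervalIntegrable (by fun_prop) _ _)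
          (Continuous.intervalIntegrable (by fun_prop) _ _)]
        congr 1; ext y
        simp [evenExt, mul_add]
      map_smul' := fun c v => by
        simp only [RingHom.id_apply, smul_eq_mul]
        rw [← intervalIntegral.integral_const_mul]
        congr 1; ext y
        simp only [evenExt, ContinuousMap.smul_apply, smul_eq_mul]
        ring }
    (Real.exp (‖k‖ * Λ) * Λ) fun w => by
      refine (norm_laplace_le (continuous_evenExt hΛ w) hΛ (norm_nonneg k)
        (Complex.re_le_norm k)).trans ?_
      rw [mul_assoc]
      refine mul_le_mul_of_nonneg_left ?_ (Real.exp_pos _).le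
      have := intervalIntegral.integral_mono_on (a := 0) (b := Λ) (μ := volume) hΛ
        ((continuous_evenExt hΛ w).norm.intervalIntegrable _ _)
        (continuous_const.intervalIntegrable _ _) (fun y _ => norm_evenExt_le hΛ w y)
      simpa using this

theorem laplaceCLM_apply {Λ : ℝ} (hΛ : 0 ≤ Λ) (k : ℂ) (w : C(Icc (0 : ℝ) Λ, ℂ)) :
    laplaceCLM hΛ k w = ∫ y in (0 : ℝ)..Λ, Complex.exp (k * (Λ - y)) * evenExt hΛ w y := rfl

theorem norm_laplaceCLM_apply_le {Λ : ℝ} (hΛ : 0 ≤ Λ) (k : ℂ) (w : C(Icc (0 : ℝ) Λ, ℂ)) :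
    ‖laplaceCLM hΛ k w‖ ≤ Real.exp (‖k‖ * Λ) * Λ * ‖w‖ :=
  ContinuousLinearMap.le_of_opNorm_le _ (LinearMap.mkContinuous_norm_le _ (by positivity) _) w

theorem norm_laplaceCLM_secondPrimitive_sub_le {Λ : ℝ} (hΛ : 0 ≤ Λ) (k : ℂ)
    {z w : C(Icc (0 : ℝ) Λ, ℂ)}
    (hz : ∀ x : Icc (0 : ℝ) Λ, z x = ∫ s in (0 : ℝ)..x, (((x : ℝ) - s : ℝ) : ℂ) * evenExt hΛ w s) :
    ‖laplaceCLM hΛ k w - k ^ 2 * laplaceCLM hΛ k z‖ ≤ (1 + ‖k‖ * Λ) * Λ * ‖w‖ := by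
  set W := evenExt hΛ w with hWdef
  have hW : Continuous W := continuous_evenExt _ _
  let Z : ℝ → ℂ := fun y => ∫ s in (0 : ℝ)..y, ((y - s : ℝ) : ℂ) * W s
  let Z' : ℝ → ℂ := fun y => ∫ s in (0 : ℝ)..y, W s
  have hZ : ∀ y, HasDerivAt Z (Z' y) y := fun y => by
    have := hasDerivAt_integral_variable_upper (g := fun y s => ((y - s : ℝ) : ℂ) * W s)
      (g' := fun _ s => W s) (by fun_prop) (by fun_prop) (fun y s => by
        have h1 : HasDerivAt (fun y : ℝ => y - s) 1 y := (hasDerivAt_id y).sub_const _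
        simpa using h1.ofReal_comp.mul_const (W s)) y
    exact this.congr_deriv (by simp [Z'])
  have hZ' : ∀ y, HasDerivAt Z' (W y) y := fun y =>
    intervalIntegral.integral_hasDerivAt_right (hW.intervalIntegrable _ _)
      (hW.stronglyMeasurableAtFilter _ _) hW.continuousAt
  have hZc : Continuous Z := continuous_iff_continuousAt.2 fun x => (hZ x).continuousAt
  have hd : ∀ y : ℝ, HasDerivAt (fun y : ℝ => Complex.exp (k * (Λ - y)) * (Z' y + k * Z y))
      (Complex.exp (k * (Λ - y)) * W y - k ^ 2 * (Complex.exp (k * (Λ - y)) * Z y)) y := by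
    intro y
    have h1 : HasDerivAt (fun y : ℝ => k * ((Λ : ℂ) - y)) (k * -1) y := by
      have : HasDerivAt (fun y : ℝ => (y : ℂ)) 1 y := by
        simpa using (hasDerivAt_id y).ofReal_comp
      simpa using (this.const_sub (Λ : ℂ)).const_mul k
    refine (h1.cexp.mul ((hZ' y).add ((hZ y).const_mul k))).congr_deriv ?_
    simp only [Pi.add_apply]
    ring
  have hI := intervalIntegral.integral_eq_sub_of_hasDerivAt (a := 0) (b := Λ) (fun y _ => hd y)
    (Continuous.intervalIntegrable (by fun_prop) _ _)
  rw [intervalIntegral.integral_sub (Continuous.intervalIntegrable (by fun_prop) _ _)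
    (Continuous.intervalIntegrable (by fun_prop) _ _), intervalIntegral.integral_const_mul] at hI
  have hz' : laplaceCLM hΛ k z = ∫ y in (0 : ℝ)..Λ, Complex.exp (k * (Λ - y)) * Z y := by
    rw [laplaceCLM_apply]
    refine intervalIntegral.integral_congr fun y hy => ?_
    rw [uIcc_of_le hΛ] at hy
    rw [evenExt_of_mem hΛ z hy, hz]
  rw [hz', laplaceCLM_apply, hI]
  have hZ'b : ‖Z' Λ‖ ≤ ‖w‖ * Λ := by
    have := intervalIntegral.norm_integral_le_of_norm_le_const (a := (0 : ℝ)) (b := Λ)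
      (C := ‖w‖) (f := W) fun s _ => norm_evenExt_le hΛ w s
    rwa [sub_zero, abs_of_nonneg hΛ] at this
  have hZb : ‖Z Λ‖ ≤ Λ * ‖w‖ * Λ := by
    have := intervalIntegral.norm_integral_le_of_norm_le_const (a := (0 : ℝ)) (b := Λ)
      (C := Λ * ‖w‖) (f := fun s => ((Λ - s : ℝ) : ℂ) * W s) fun s hs => by
        rw [uIoc_of_le hΛ] at hs
        rw [norm_mul, Complex.norm_real, Real.norm_eq_abs, abs_of_nonneg (by linarith [hs.2])]
        exact mul_le_mul (by linarith [hs.1]) (norm_evenExt_le hΛ w s) (norm_nonneg _) hΛ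
    rwa [sub_zero, abs_of_nonneg hΛ] at this
  have h0 : Z' 0 + k * Z 0 = 0 := by simp [Z, Z']
  rw [h0, mul_zero, sub_zero, sub_self, mul_zero, Complex.exp_zero, one_mul]
  calc ‖Z' Λ + k * Z Λ‖ ≤ ‖Z' Λ‖ + ‖k‖ * ‖Z Λ‖ := (norm_add_le _ _).trans (by rw [norm_mul])
    _ ≤ ‖w‖ * Λ + ‖k‖ * (Λ * ‖w‖ * Λ) := by gcongr
    _ = _ := by ring

theorem norm_le_of_hasDerivAt_forced {F ρ : ℝ → ℂ} {lam : ℂ} {K t₁ t₂ : ℝ} (hlam : 0 < lam.re)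
    (ht : t₁ ≤ t₂) (hF : ∀ t ∈ Icc t₁ t₂, HasDerivAt F (-lam * F t + ρ t) t)
    (hρ : ∀ t ∈ Icc t₁ t₂, ‖ρ t‖ ≤ K) :
    ‖F t₂‖ ≤ Real.exp (-(lam.re * (t₂ - t₁))) * ‖F t₁‖ + K / lam.re := by
  have hK : 0 ≤ K := (norm_nonneg _).trans (hρ t₁ ⟨le_rfl, ht⟩)
  have hg : ∀ t ∈ Icc t₁ t₂, HasDerivAt (fun t : ℝ => Complex.exp (lam * (t - t₁ : ℝ)) * F t)
      (Complex.exp (lam * (t - t₁ : ℝ)) * ρ t) t := by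
    intro t ht
    have h1 : HasDerivAt (fun t : ℝ => lam * ((t - t₁ : ℝ) : ℂ)) lam t := by
      have : HasDerivAt (fun t : ℝ => t - t₁) 1 t := (hasDerivAt_id t).sub_const _
      simpa using this.ofReal_comp.const_mul lam
    exact (h1.cexp.mul (hF t ht)).congr_deriv (by ring)
  have hB : ∀ t, HasDerivAt (fun t : ℝ => ‖F t₁‖ + K / lam.re * (Real.exp (lam.re * (t - t₁)) - 1))
      (K * Real.exp (lam.re * (t - t₁))) t := by
    intro t
    have h1 : HasDerivAt (fun t : ℝ => lam.re * (t - t₁)) lam.re t := by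
      simpa using ((hasDerivAt_id t).sub_const t₁).const_mul lam.re
    refine (((h1.exp.sub_const 1).const_mul (K / lam.re)).const_add ‖F t₁‖).congr_deriv ?_
    field_simp
  have hexp : ∀ t : ℝ, ‖Complex.exp (lam * (t - t₁ : ℝ))‖ = Real.exp (lam.re * (t - t₁)) := by
    intro t
    rw [Complex.norm_exp, Complex.re_mul_ofReal]
  have := image_norm_le_of_norm_deriv_right_le_deriv_boundary (a := t₁) (b := t₂)
    (fun t ht => (hg t ht).continuousAt.continuousWithinAt)
    (fun t ht => (hg t ⟨ht.1, ht.2.le⟩).hasDerivWithinAt)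
    (B := fun t : ℝ => ‖F t₁‖ + K / lam.re * (Real.exp (lam.re * (t - t₁)) - 1))
    (by simp) hB (fun t ht => by
      rw [norm_mul, hexp, mul_comm]
      exact mul_le_mul_of_nonneg_right (hρ t ⟨ht.1, ht.2.le⟩) (Real.exp_pos _).le)
    (right_mem_Icc.2 ht)
  rw [norm_mul, hexp] at this
  have hE : Real.exp (-(lam.re * (t₂ - t₁))) * Real.exp (lam.re * (t₂ - t₁)) = 1 := by
    rw [← Real.exp_add, neg_add_cancel, Real.exp_zero]
  have hE0 := Real.exp_pos (-(lam.re * (t₂ - t₁)))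
  calc ‖F t₂‖ = Real.exp (-(lam.re * (t₂ - t₁))) * (Real.exp (lam.re * (t₂ - t₁)) * ‖F t₂‖) := by
        rw [← mul_assoc, hE, one_mul]
    _ ≤ Real.exp (-(lam.re * (t₂ - t₁))) *
        (‖F t₁‖ + K / lam.re * (Real.exp (lam.re * (t₂ - t₁)) - 1)) := by gcongr
    _ = Real.exp (-(lam.re * (t₂ - t₁))) * ‖F t₁‖ +
        K / lam.re * (Real.exp (-(lam.re * (t₂ - t₁))) * Real.exp (lam.re * (t₂ - t₁)) -
          Real.exp (-(lam.re * (t₂ - t₁)))) := by ring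
    _ ≤ _ := by
        rw [hE]
        have : 0 ≤ K / lam.re := by positivity
        gcongr
        exact mul_le_of_le_one_right this (by linarith)

theorem exists_ray {σ : ℂ} (hσ : σ ≠ 0) :
    ∃ ω μ : ℂ, ω ^ 2 = -σ * μ ∧ 0 < ω.re ∧ 0 < μ.re := by
  obtain ⟨ω, hω⟩ := IsAlgClosed.exists_pow_nat_eq (-σ) (n := 2) two_pos
  have h0 : ω ≠ 0 := by rintro rfl; apply hσ; simpa using hω.symm
  rcases lt_trichotomy ω.re 0 with h | h | h
  · exact ⟨-ω, 1, by rw [neg_sq, hω, mul_one], by simpa using h, by simp⟩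
  · have him : ω.im ≠ 0 := fun h' => h0 (Complex.ext h h')
    rcases lt_or_gt_of_ne him with h' | h'
    · refine ⟨ω * (1 + Complex.I / 2), (1 + Complex.I / 2) ^ 2, by rw [mul_pow, hω], ?_, ?_⟩
      · simp [h]; linarith
      · norm_num [sq]
    · refine ⟨ω * (1 - Complex.I / 2), (1 - Complex.I / 2) ^ 2, by rw [mul_pow, hω], ?_, ?_⟩
      · simp [h]; linarith
      · norm_num [sq]
  · exact ⟨ω, 1, by rw [hω, mul_one], h, by simp⟩

theorem laplaceCLM_ray_bound {Λ : ℝ} (hΛ : 0 ≤ Λ) {σ ω μ : ℂ} (hσ : σ ≠ 0)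
    (hωμ : ω ^ 2 = -σ * μ) (hμ : 0 < μ.re) {Z Zt : ℝ → C(Icc (0 : ℝ) Λ, ℂ)} (hZt : Continuous Zt)
    {t₁ t₂ : ℝ} (ht : t₁ < t₂) (hZ : ∀ t ∈ Icc t₁ t₂, HasDerivAt Z (Zt t) t)
    (heq : ∀ t ∈ Icc t₁ t₂, ∀ x : Icc (0 : ℝ) Λ,
      Z t x = σ * ∫ s in (0 : ℝ)..x, (((x : ℝ) - s : ℝ) : ℂ) * evenExt hΛ (Zt t) s) :
    ∃ C, ∀ r : ℝ, 0 < r → ‖laplaceCLM hΛ (r * ω) (Z t₂)‖ ≤ C := by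
  obtain ⟨M, hM⟩ := (isCompact_Icc (a := t₁) (b := t₂)).exists_bound_of_continuousOn
    hZt.continuousOn
  have hM0 : 0 ≤ M := (norm_nonneg _).trans (hM t₁ ⟨le_rfl, ht.le⟩)
  set n := ‖ω‖
  have hn : 0 ≤ n := norm_nonneg _
  have hτ : 0 < t₂ - t₁ := sub_pos.2 ht
  refine ⟨Real.exp ((n * Λ) ^ 2 / (4 * (μ.re * (t₂ - t₁)))) * Λ * ‖Z t₁‖ +
    (1 + n * Λ) * Λ * M / μ.re + Real.exp (n * Λ) * Λ * ‖Z t₂‖, fun r hr => ?_⟩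
  have hkn : ‖(r : ℂ) * ω‖ = r * n := by
    rw [norm_mul, Complex.norm_real, Real.norm_of_nonneg hr.le]
  rcases le_total r 1 with hr1 | hr1
  · refine (norm_laplaceCLM_apply_le hΛ _ _).trans ?_
    rw [hkn]
    have : Real.exp (r * n * Λ) * Λ * ‖Z t₂‖ ≤ Real.exp (n * Λ) * Λ * ‖Z t₂‖ := by
      gcongr
      exact mul_le_of_le_one_left hn hr1
    have : 0 ≤ (1 + n * Λ) * Λ * M / μ.re := by positivity
    have : 0 ≤ Real.exp ((n * Λ) ^ 2 / (4 * (μ.re * (t₂ - t₁)))) * Λ * ‖Z t₁‖ := by positivity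
    linarith
  set k : ℂ := r * ω with hk
  set lam : ℂ := ((r ^ 2 : ℝ) : ℂ) * μ with hlamdef
  have hlam : lam.re = r ^ 2 * μ.re := Complex.re_ofReal_mul _ _
  have hk2 : k ^ 2 = -σ * lam := by
    rw [hk, mul_pow, hωμ, hlamdef]; push_cast; ring
  have hest := norm_le_of_hasDerivAt_forced (F := fun t => laplaceCLM hΛ k (Z t))
    (ρ := fun t => laplaceCLM hΛ k (Zt t) + lam * laplaceCLM hΛ k (Z t)) (lam := lam)
    (K := (1 + r * n * Λ) * Λ * M) (by rw [hlam]; positivity) ht.le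
    (fun t ht => by
      refine HasDerivAt.congr_deriv (f' := laplaceCLM hΛ k (Zt t)) ?_ (by ring)
      exact ((laplaceCLM hΛ k).restrictScalars ℝ).hasFDerivAt.comp_hasDerivAt t (hZ t ht)) (fun t ht => by
      have h1 := norm_laplaceCLM_secondPrimitive_sub_le hΛ k (z := Z t) (w := σ • Zt t) fun x => by
        rw [heq t ht x, ← intervalIntegral.integral_const_mul]
        congr 1; ext s
        simp only [evenExt, ContinuousMap.smul_apply, smul_eq_mul]
        ring
      rw [map_smul, smul_eq_mul, hk2, norm_smul, hkn,
        show σ * laplaceCLM hΛ k (Zt t) - -σ * lam * laplaceCLM hΛ k (Z t) =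
          σ * (laplaceCLM hΛ k (Zt t) + lam * laplaceCLM hΛ k (Z t)) by ring, norm_mul,
        mul_left_comm] at h1
      refine (le_of_mul_le_mul_left h1 (norm_pos_iff.2 hσ)).trans ?_
      have := hM t ht
      gcongr)
  refine hest.trans ?_
  rw [hlam]
  have e1 : Real.exp (-(r ^ 2 * μ.re * (t₂ - t₁))) * ‖laplaceCLM hΛ k (Z t₁)‖ ≤
      Real.exp ((n * Λ) ^ 2 / (4 * (μ.re * (t₂ - t₁)))) * Λ * ‖Z t₁‖ := by
    calc _ ≤ Real.exp (-(r ^ 2 * μ.re * (t₂ - t₁))) * (Real.exp (r * n * Λ) * Λ * ‖Z t₁‖) := by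
          rw [← hkn]; gcongr; exact norm_laplaceCLM_apply_le hΛ _ _
      _ = Real.exp (-(r ^ 2 * μ.re * (t₂ - t₁)) + r * n * Λ) * Λ * ‖Z t₁‖ := by
          rw [Real.exp_add]; ring
      _ ≤ _ := by
          gcongr
          have hm : 0 < μ.re * (t₂ - t₁) := by positivity
          rw [le_div_iff₀ (by positivity)]
          nlinarith [sq_nonneg (n * Λ - 2 * r * (μ.re * (t₂ - t₁)))]
  have e2 : (1 + r * n * Λ) * Λ * M / (r ^ 2 * μ.re) ≤ (1 + n * Λ) * Λ * M / μ.re := by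
    rw [div_le_div_iff₀ (by positivity) hμ]
    have h1 : 1 + r * n * Λ ≤ (1 + n * Λ) * r ^ 2 := by
      have : 1 ≤ r ^ 2 := one_le_pow₀ hr1
      have : r ≤ r ^ 2 := le_self_pow₀ hr1 two_ne_zero
      have := mul_le_mul_of_nonneg_right this (mul_nonneg hn hΛ)
      linarith
    calc (1 + r * n * Λ) * Λ * M * μ.re ≤ ((1 + n * Λ) * r ^ 2) * Λ * M * μ.re := by gcongr
      _ = _ := by ring
  have : 0 ≤ Real.exp (n * Λ) * Λ * ‖Z t₂‖ := by positivity
  linarith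

/-- Unique continuation from the lateral boundary for `∂ₓ² Z = σ ∂ₜ Z`. -/
theorem deriv_eq_zero_of_zero_cauchy_data {Λ T : ℝ} (hΛ : 0 < Λ) (hT : 0 < T) {σ : ℂ}
    (hσ : σ ≠ 0) {Z Zt : ℝ → C(Icc (0 : ℝ) Λ, ℂ)} (hZt : Continuous Zt)
    (hZ : ∀ t ∈ Ioo 0 T, HasDerivAt Z (Zt t) t)
    (heq : ∀ t ∈ Ioo 0 T, ∀ x : Icc (0 : ℝ) Λ,
      Z t x = σ * ∫ s in (0 : ℝ)..x, (((x : ℝ) - s : ℝ) : ℂ) * evenExt hΛ.le (Zt t) s) :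
    Zt T = 0 := by
  have hzero : ∀ t ∈ Ioo 0 T, Z t = 0 := by
    intro t ht
    obtain ⟨ω, μ, hωμ, hω, hμ⟩ := exists_ray hσ
    have hsub : ∀ s ∈ Icc (t / 2) t, s ∈ Ioo 0 T := fun s hs =>
      ⟨by linarith [hs.1, ht.1], hs.2.trans_lt ht.2⟩
    obtain ⟨C, hC⟩ := laplaceCLM_ray_bound hΛ.le hσ hωμ hμ hZt (half_lt_self ht.1)
      (fun s hs => hZ s (hsub s hs)) (fun s hs => heq s (hsub s hs))
    have h1 := eq_zero_of_laplace_bounded_on_ray (continuous_evenExt hΛ.le (Z t)) hω hC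
    have h2 : EqOn (evenExt hΛ.le (Z t)) (fun _ => 0) (closure (Ioo 0 Λ)) :=
      EqOn.closure h1 (continuous_evenExt hΛ.le (Z t)) continuous_const
    rw [closure_Ioo hΛ.ne] at h2
    ext x
    rw [← evenExt_of_mem hΛ.le (Z t) x.2]
    exact h2 x.2
  have hd : EqOn Zt (fun _ => 0) (Ioo 0 T) := fun t ht => by
    have : Z =ᶠ[𝓝 t] fun _ => 0 := by
      filter_upwards [Ioo_mem_nhds ht.1 ht.2] with s hs using hzero s hs
    exact (hZ t ht).unique ((hasDerivAt_const t _).congr_of_eventuallyEq this)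
  have := hd.closure hZt continuous_const
  rw [closure_Ioo hT.ne] at this
  exact this (right_mem_Icc.2 hT.le)

theorem integral_norm_mono {f : ℝ → ℂ} (hf : Continuous f) {a b c d : ℝ} (hca : c ≤ a)
    (hab : a ≤ b) (hbd : b ≤ d) : ∫ s in a..b, ‖f s‖ ≤ ∫ s in c..d, ‖f s‖ :=
  intervalIntegral.integral_mono_interval hca hab hbd
    (Eventually.of_forall fun _ => norm_nonneg _) (hf.norm.intervalIntegrable _ _)

theorem integral_norm_comp_add_right_le {f : ℝ → ℂ} (hf : Continuous f) {ξ y : ℝ} (hξ : 0 ≤ ξ)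
    (hy : 0 ≤ y) : ∫ x in (0 : ℝ)..ξ, ‖f (x + y)‖ ≤ ∫ s in (0 : ℝ)..(ξ + y), ‖f s‖ := by
  rw [intervalIntegral.integral_comp_add_right (fun s => ‖f s‖), zero_add]
  exact integral_norm_mono hf hy (by linarith) le_rfl

namespace IsGoursatKernel

variable {Λ : ℝ} {P Q : ℝ → ℂ} {h : ℂ} {κ κη κ₀ θ θη θ₀ : ℝ → ℝ → ℂ}

theorem deriv_eq (hk : IsGoursatKernel Λ P h κ κη κ₀) (hP : Continuous P) (ξ η : ℝ) :
    κη ξ η = P η + ∫ x in (0 : ℝ)..ξ, P (x + η) * κ₀ x η := by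
  rw [intervalIntegral.integral_eq_sub_of_hasDerivAt (fun x _ => hk.hasDerivAt_left x η)
    (Continuous.intervalIntegrable ((hP.comp (by fun_prop)).mul
      (hk.cont_ext.comp (by fun_prop : Continuous fun x : ℝ => (x, η)))) _ _), hk.left_zero]
  ring

theorem eq_integral_deriv (hk : IsGoursatKernel Λ P h κ κη κ₀) (ξ η : ℝ) :
    κ ξ η = h + ∫ y in (0 : ℝ)..η, κη ξ y := by
  rw [intervalIntegral.integral_eq_sub_of_hasDerivAt (fun y _ => hk.hasDerivAt_right ξ y)
    (Continuous.intervalIntegrable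
      (hk.cont_deriv.comp (by fun_prop : Continuous fun y : ℝ => (ξ, y))) _ _), hk.right_zero]
  ring

theorem deriv_sub_deriv (hk : IsGoursatKernel Λ P h κ κη κ₀) (hP : Continuous P)
    (hθ : IsGoursatKernel Λ Q h θ θη θ₀) (hQ : Continuous Q) {ξ η : ℝ} (hξ : ξ ∈ Icc 0 Λ)
    (hη : η ∈ Icc 0 Λ) :
    κη ξ η - θη ξ η = (P η - Q η) + ∫ x in (0 : ℝ)..ξ,
      (P (x + η) * (κ x η - θ x η) + (P (x + η) - Q (x + η)) * θ x η) := by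
  have hc : Continuous fun x : ℝ => (x, η) := by fun_prop
  have h1 : Continuous fun x => P (x + η) * κ₀ x η :=
    (hP.comp (by fun_prop)).mul (hk.cont_ext.comp hc)
  have h2 : Continuous fun x => Q (x + η) * θ₀ x η :=
    (hQ.comp (by fun_prop)).mul (hθ.cont_ext.comp hc)
  rw [hk.deriv_eq hP, hθ.deriv_eq hQ, add_sub_add_comm, ← intervalIntegral.integral_sub
    (h1.intervalIntegrable _ _) (h2.intervalIntegrable _ _)]
  congr 1
  refine intervalIntegral.integral_congr fun x hx => ?_
  rw [uIcc_of_le hξ.1] at hx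
  have hx' : x ∈ Icc 0 Λ := ⟨hx.1, hx.2.trans hξ.2⟩
  rw [hk.ext_eq x hx' η hη, hθ.ext_eq x hx' η hη]
  ring

theorem sub_eq_integral (hk : IsGoursatKernel Λ P h κ κη κ₀)
    (hθ : IsGoursatKernel Λ Q h θ θη θ₀) (ξ η : ℝ) :
    κ ξ η - θ ξ η = ∫ y in (0 : ℝ)..η, (κη ξ y - θη ξ y) := by
  have hc : Continuous fun y : ℝ => (ξ, y) := by fun_prop
  have h1 : Continuous fun y => κη ξ y := hk.cont_deriv.comp hc
  have h2 : Continuous fun y => θη ξ y := hθ.cont_deriv.comp hc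
  rw [hk.eq_integral_deriv, hθ.eq_integral_deriv, intervalIntegral.integral_sub
    (h1.intervalIntegrable _ _) (h2.intervalIntegrable _ _)]
  ring

theorem norm_deriv_sub_le (hk : IsGoursatKernel Λ P h κ κη κ₀) (hP : Continuous P)
    (hθ : IsGoursatKernel Λ Q h θ θη θ₀) (hQ : Continuous Q) :
    ∃ M, 0 ≤ M ∧ ∀ ξ η, 0 ≤ ξ → 0 ≤ η → ξ + η ≤ Λ →
      ‖κη ξ η - θη ξ η - ∫ x in (0 : ℝ)..ξ, P (x + η) * (κ x η - θ x η)‖ ≤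
        ‖P η - Q η‖ + M * ∫ s in (0 : ℝ)..(ξ + η), ‖P s - Q s‖ := by
  obtain ⟨M, hM⟩ := ((isCompact_Icc (a := (0 : ℝ)) (b := Λ)).prod
    (isCompact_Icc (a := (0 : ℝ)) (b := Λ))).exists_bound_of_continuousOn hθ.cont.continuousOn
  refine ⟨|M|, abs_nonneg M, fun ξ η hξ hη hΛ => ?_⟩
  have hf : Continuous fun s => P s - Q s := hP.sub hQ
  have hη' : η ∈ Icc 0 Λ := ⟨hη, by linarith⟩
  have hc : Continuous fun x : ℝ => (x, η) := by fun_prop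
  have hκ : Continuous fun x => κ x η := hk.cont.comp hc
  have hθ' : Continuous fun x => θ x η := hθ.cont.comp hc
  rw [hk.deriv_sub_deriv hP hθ hQ ⟨hξ, by linarith⟩ hη', intervalIntegral.integral_add
    (Continuous.intervalIntegrable (by fun_prop) _ _)
    (Continuous.intervalIntegrable (by fun_prop) _ _), add_sub_assoc, add_sub_cancel_left]
  refine (norm_add_le _ _).trans (add_le_add_right ?_ _)
  calc _ ≤ ∫ x in (0 : ℝ)..ξ, |M| * ‖P (x + η) - Q (x + η)‖ := by
        refine intervalIntegral.norm_integral_le_of_norm_le hξ (Eventually.of_forall fun x hx => ?_)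
          (Continuous.intervalIntegrable (by fun_prop) _ _)
        rw [norm_mul, mul_comm]
        gcongr
        exact (hM (x, η) ⟨⟨hx.1.le, by linarith [hx.2]⟩, hη'⟩).trans (le_abs_self M)
    _ ≤ _ := by
        rw [intervalIntegral.integral_const_mul]
        gcongr
        exact integral_norm_comp_add_right_le hf hξ hη

theorem norm_sub_le_integral (hΛ : 0 ≤ Λ) (hk : IsGoursatKernel Λ P h κ κη κ₀) (hP : Continuous P)
    (hθ : IsGoursatKernel Λ Q h θ θη θ₀) (hQ : Continuous Q) :
    ∃ M, 0 ≤ M ∧ ∀ ξ η, 0 ≤ ξ → 0 ≤ η → ξ + η ≤ Λ →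
      ‖κ ξ η - θ ξ η‖ ≤ M * ∫ s in (0 : ℝ)..(ξ + η), ‖P s - Q s‖ := by
  obtain ⟨M, hM0, hM⟩ := hk.norm_deriv_sub_le hP hθ hQ
  obtain ⟨N, hN⟩ := (isCompact_Icc (a := (0 : ℝ)) (b := Λ)).exists_bound_of_continuousOn
    hP.continuousOn
  have hN0 : 0 ≤ N := (norm_nonneg _).trans (hN 0 ⟨le_rfl, hΛ⟩)
  have hf : Continuous fun s => P s - Q s := hP.sub hQ
  have hN1 : 0 < 1 + 2 * N := by positivity
  obtain ⟨k, hkpos, hkN⟩ : ∃ k : ℝ, 0 < k ∧ k ^ 2 = 1 + 2 * N :=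
    ⟨√(1 + 2 * N), Real.sqrt_pos.2 hN1, Real.sq_sqrt hN1.le⟩
  refine ⟨2 * (1 + M * Λ) * Real.exp (k * Λ), by positivity, fun ξ₁ η₁ hξ₁ hη₁ hr => ?_⟩
  set r := ξ₁ + η₁ with hrdef
  set φ := ∫ s in (0 : ℝ)..r, ‖P s - Q s‖ with hφ
  have hφ0 : 0 ≤ φ := intervalIntegral.integral_nonneg (add_nonneg hξ₁ hη₁) fun _ _ => norm_nonneg _
  have hcomp : IsCompact {z : ℝ × ℝ | 0 ≤ z.1 ∧ 0 ≤ z.2 ∧ z.1 + z.2 ≤ r} := by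
    refine IsCompact.of_isClosed_subset ((isCompact_Icc (a := (0 : ℝ)) (b := r)).prod
      (isCompact_Icc (a := (0 : ℝ)) (b := r))) ?_ ?_
    · exact (isClosed_le continuous_const continuous_fst).inter
        ((isClosed_le continuous_const continuous_snd).inter
          (isClosed_le (continuous_fst.add continuous_snd) continuous_const))
    · rintro z ⟨h1, h2, h3⟩
      exact ⟨⟨h1, by linarith⟩, ⟨h2, by linarith⟩⟩
  have hcont : Continuous fun z : ℝ × ℝ => Real.exp (-(k * (z.1 + z.2))) *
      ‖κ z.1 z.2 - θ z.1 z.2‖ := by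
    have := (hk.cont.sub hθ.cont).norm
    fun_prop
  obtain ⟨⟨ξ, η⟩, ⟨hξ, hη, hs⟩, hmax⟩ := hcomp.exists_isMaxOn
    ⟨(ξ₁, η₁), hξ₁, hη₁, le_rfl⟩ hcont.continuousOn
  simp only at hξ hη hs
  set m := Real.exp (-(k * (ξ + η))) * ‖κ ξ η - θ ξ η‖ with hm
  have hm0 : 0 ≤ m := by positivity
  have hD : ∀ x y, 0 ≤ x → 0 ≤ y → x + y ≤ r →
      ‖κ x y - θ x y‖ ≤ m * Real.exp (k * (x + y)) := by
    intro x y hx hy hxy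
    have : Real.exp (-(k * (x + y))) * ‖κ x y - θ x y‖ ≤ m := hmax (a := (x, y)) ⟨hx, hy, hxy⟩
    rwa [Real.exp_neg, inv_mul_le_iff₀ (Real.exp_pos _), mul_comm] at this
  have hκc : Continuous fun z : ℝ × ℝ => P (z.1 + z.2) * (κ z.1 z.2 - θ z.1 z.2) :=
    (hP.comp (by fun_prop)).mul (hk.cont.sub hθ.cont)
  have hIc : Continuous fun y => ∫ x in (0 : ℝ)..ξ, P (x + y) * (κ x y - θ x y) :=
    intervalIntegral.continuous_parametric_intervalIntegral_of_continuous' (μ := volume)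
      (f := fun y x => P (x + y) * (κ x y - θ x y)) (hκc.comp continuous_swap) _ _
  have hDc : Continuous fun y => κη ξ y - θη ξ y :=
    (hk.cont_deriv.sub hθ.cont_deriv).comp (by fun_prop : Continuous fun y : ℝ => (ξ, y))
  have h1 : ‖κ ξ η - θ ξ η‖ ≤ (1 + M * Λ) * φ + N * m / k ^ 2 * Real.exp (k * (ξ + η)) := by
    have e : κ ξ η - θ ξ η =
        (∫ y in (0 : ℝ)..η, (κη ξ y - θη ξ y - ∫ x in (0 : ℝ)..ξ, P (x + y) * (κ x y - θ x y))) +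
          ∫ y in (0 : ℝ)..η, ∫ x in (0 : ℝ)..ξ, P (x + y) * (κ x y - θ x y) := by
      rw [hk.sub_eq_integral hθ, intervalIntegral.integral_sub (hDc.intervalIntegrable _ _)
        (hIc.intervalIntegrable _ _)]
      ring
    rw [e]
    refine (norm_add_le _ _).trans (add_le_add ?_ ?_)
    · calc _ ≤ ∫ y in (0 : ℝ)..η, (‖P y - Q y‖ + M * φ) := by
            refine intervalIntegral.norm_integral_le_of_norm_le hη
              (Eventually.of_forall fun y hy => ?_)
              (Continuous.intervalIntegrable (by fun_prop) _ _)
            refine (hM ξ y hξ hy.1.le (by linarith [hy.2])).trans ?_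
            gcongr
            exact integral_norm_mono hf le_rfl (by linarith [hy.1]) (by linarith [hy.2])
        _ = (∫ y in (0 : ℝ)..η, ‖P y - Q y‖) + η * (M * φ) := by
            rw [intervalIntegral.integral_add (hf.norm.intervalIntegrable _ _)
              (continuous_const.intervalIntegrable _ _), intervalIntegral.integral_const, sub_zero,
              smul_eq_mul]
        _ ≤ φ + Λ * (M * φ) := by
            gcongr
            · exact integral_norm_mono hf le_rfl hη (by linarith)
            · linarith
        _ = _ := by ring
    · refine norm_double_integral_exp_le (by positivity) hkpos hξ hη fun x hx y hy => ?_
      rw [norm_mul, mul_assoc]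
      have hxy : x + y ≤ r := by linarith [hx.2, hy.2]
      exact mul_le_mul (hN _ ⟨add_nonneg hx.1 hy.1, by linarith⟩) (hD x y hx.1 hy.1 hxy)
        (norm_nonneg _) hN0
  have h2 : m ≤ 2 * ((1 + M * Λ) * φ) := by
    have h3 : N * m / k ^ 2 ≤ m / 2 := by
      rw [hkN, div_le_iff₀ hN1]; nlinarith
    have h4 : ‖κ ξ η - θ ξ η‖ = m * Real.exp (k * (ξ + η)) := by
      rw [hm, Real.exp_neg]; field_simp
    have hE : 1 ≤ Real.exp (k * (ξ + η)) := Real.one_le_exp (by positivity)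
    have h5 : 0 ≤ (1 + M * Λ) * φ := by positivity
    rw [h4] at h1
    have h6 : m * Real.exp (k * (ξ + η)) ≤ (1 + M * Λ) * φ * Real.exp (k * (ξ + η)) +
        m / 2 * Real.exp (k * (ξ + η)) :=
      h1.trans (add_le_add (le_mul_of_one_le_right h5 hE)
        (mul_le_mul_of_nonneg_right h3 (by positivity)))
    rw [← add_mul] at h6
    have := le_of_mul_le_mul_right h6 (by positivity)
    linarith
  calc ‖κ ξ₁ η₁ - θ ξ₁ η₁‖ ≤ m * Real.exp (k * r) := hD ξ₁ η₁ hξ₁ hη₁ le_rfl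
    _ ≤ 2 * ((1 + M * Λ) * φ) * Real.exp (k * Λ) := by gcongr
    _ = _ := by ring

theorem norm_sub_le_of_eqOn (hΛ : 0 ≤ Λ) (hk : IsGoursatKernel Λ P h κ κη κ₀) (hP : Continuous P)
    (hθ : IsGoursatKernel Λ Q h θ θη θ₀) (hQ : Continuous Q) :
    ∃ M, 0 ≤ M ∧ ∀ x₀ x, x₀ ∈ Icc 0 Λ → x ∈ Icc x₀ Λ → ∫ s in (0 : ℝ)..x₀, ‖P s - Q s‖ = 0 →
      ∀ ξ ∈ Icc 0 x, ‖κ ξ (x - ξ) - θ ξ (x - ξ)‖ ≤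
        (∫ s in (0 : ℝ)..(x - ξ), ‖P s - Q s‖) + M * (x - x₀) * ∫ s in (0 : ℝ)..x, ‖P s - Q s‖ := by
  obtain ⟨M₁, hM₁0, hM₁⟩ := hk.norm_deriv_sub_le hP hθ hQ
  obtain ⟨M₂, hM₂0, hM₂⟩ := hk.norm_sub_le_integral hΛ hP hθ hQ
  obtain ⟨N, hN⟩ := (isCompact_Icc (a := (0 : ℝ)) (b := Λ)).exists_bound_of_continuousOn
    hP.continuousOn
  have hN0 : 0 ≤ N := (norm_nonneg _).trans (hN 0 ⟨le_rfl, hΛ⟩)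
  have hf : Continuous fun s => P s - Q s := hP.sub hQ
  refine ⟨M₁ + N * M₂ * Λ, by positivity, fun x₀ x hx₀ hx heq ξ hξ => ?_⟩
  have hx0 : 0 ≤ x := hx₀.1.trans hx.1
  set φ : ℝ → ℝ := fun r => ∫ s in (0 : ℝ)..r, ‖P s - Q s‖ with hφ
  have hφc : Continuous φ := intervalIntegral.continuous_primitive
    (fun a b => hf.norm.intervalIntegrable a b) 0
  have hφmono : ∀ a b, 0 ≤ a → a ≤ b → φ a ≤ φ b := fun a b ha hab =>
    integral_norm_mono hf le_rfl ha hab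
  have hφ0 : ∀ a, 0 ≤ a → 0 ≤ φ a := fun a ha =>
    intervalIntegral.integral_nonneg ha fun _ _ => norm_nonneg _
  have hφz : ∀ a ∈ Icc 0 x₀, φ a = 0 := fun a ha => by
    exact le_antisymm ((hφmono _ _ ha.1 ha.2).trans_eq heq) (hφ0 a ha.1)
  have hder : ∀ y ∈ Ioc 0 (x - ξ), ‖κη ξ y - θη ξ y‖ ≤
      ‖P y - Q y‖ + (M₁ + N * M₂ * Λ) * φ (y + ξ) := by
    intro y hy
    have hle : ξ + y ≤ Λ := by linarith [hy.2, hx.2]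
    have hint : ‖∫ x in (0 : ℝ)..ξ, P (x + y) * (κ x y - θ x y)‖ ≤ N * (M₂ * φ (ξ + y)) * |ξ - 0| := by
      refine intervalIntegral.norm_integral_le_of_norm_le_const fun x' hx' => ?_
      rw [uIoc_of_le hξ.1] at hx'
      have h1 : x' + y ≤ ξ + y := by linarith [hx'.2]
      rw [norm_mul]
      refine mul_le_mul (hN _ ⟨add_nonneg hx'.1.le hy.1.le, by linarith⟩) ?_ (norm_nonneg _) hN0
      refine (hM₂ x' y hx'.1.le hy.1.le (by linarith)).trans ?_
      exact mul_le_mul_of_nonneg_left (hφmono _ _ (add_nonneg hx'.1.le hy.1.le) h1) hM₂0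
    have hsplit : κη ξ y - θη ξ y = (κη ξ y - θη ξ y -
        ∫ x in (0 : ℝ)..ξ, P (x + y) * (κ x y - θ x y)) +
          ∫ x in (0 : ℝ)..ξ, P (x + y) * (κ x y - θ x y) := by ring
    rw [hsplit, add_comm y ξ]
    refine (norm_add_le _ _).trans ((add_le_add (hM₁ ξ y hξ.1 hy.1.le hle) hint).trans ?_)
    rw [sub_zero, abs_of_nonneg hξ.1]
    have h3 := hφ0 (ξ + y) (add_nonneg hξ.1 hy.1.le)
    have h4 : N * (M₂ * φ (ξ + y)) * ξ ≤ N * (M₂ * φ (ξ + y)) * Λ := by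
      gcongr; linarith [hy.1]
    change ‖P y - Q y‖ + M₁ * φ (ξ + y) + _ ≤ _
    linarith
  have hint2 : ∫ y in (0 : ℝ)..(x - ξ), φ (y + ξ) ≤ (x - x₀) * φ x := by
    rw [intervalIntegral.integral_comp_add_right, zero_add, sub_add_cancel]
    have hI : ∀ a b, IntervalIntegrable φ volume a b := fun a b => hφc.intervalIntegrable a b
    calc ∫ s in ξ..x, φ s ≤ ∫ s in (0 : ℝ)..x, φ s := by
          rw [← intervalIntegral.integral_add_adjacent_intervals (hI 0 ξ) (hI ξ x)]
          have := intervalIntegral.integral_nonneg (μ := volume) hξ.1 fun s hs => hφ0 s hs.1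
          linarith
      _ = ∫ s in x₀..x, φ s := by
          rw [← intervalIntegral.integral_add_adjacent_intervals (hI 0 x₀) (hI x₀ x),
            intervalIntegral.integral_congr (a := 0) (b := x₀) (g := fun _ => 0) fun s hs => by
              rw [uIcc_of_le hx₀.1] at hs; exact hφz s hs]
          simp
      _ ≤ ∫ s in x₀..x, φ x := intervalIntegral.integral_mono_on hx.1 (hI _ _)
          (continuous_const.intervalIntegrable _ _) fun s hs => hφmono s x (hx₀.1.trans hs.1) hs.2
      _ = _ := by simp
  rw [hk.sub_eq_integral hθ]
  calc _ ≤ ∫ y in (0 : ℝ)..(x - ξ), (‖P y - Q y‖ + (M₁ + N * M₂ * Λ) * φ (y + ξ)) :=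
        intervalIntegral.norm_integral_le_of_norm_le (by linarith [hξ.2])
          (Eventually.of_forall hder) (Continuous.intervalIntegrable (by fun_prop) _ _)
    _ = φ (x - ξ) + (M₁ + N * M₂ * Λ) * ∫ y in (0 : ℝ)..(x - ξ), φ (y + ξ) := by
        rw [intervalIntegral.integral_add (hf.norm.intervalIntegrable _ _)
          (Continuous.intervalIntegrable (by fun_prop) _ _), intervalIntegral.integral_const_mul]
    _ ≤ φ (x - ξ) + (M₁ + N * M₂ * Λ) * ((x - x₀) * φ x) := by gcongr
    _ = _ := by ring

theorem norm_reflOp_sub_le (hΛ : 0 ≤ Λ) (hk : IsGoursatKernel Λ P h κ κη κ₀) (hP : Continuous P)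
    (hθ : IsGoursatKernel Λ Q h θ θη θ₀) (hQ : Continuous Q) :
    ∃ M, 0 ≤ M ∧ ∀ x₀ ∈ Icc 0 Λ, ∫ s in (0 : ℝ)..x₀, ‖P s - Q s‖ = 0 →
      ∀ (G : C(Icc (0 : ℝ) Λ, ℂ)) (x : Icc (0 : ℝ) Λ), x₀ ≤ x →
      ‖reflOp hΛ κ hk.cont G x - reflOp hΛ θ hθ.cont G x‖ ≤
        ‖G‖ * (M * (x - x₀) * ∫ s in x₀..x, ‖P s - Q s‖) := by
  obtain ⟨M, hM0, hM⟩ := hk.norm_sub_le_of_eqOn hΛ hP hθ hQ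
  refine ⟨1 + M * Λ, by positivity, fun x₀ hx₀ heq G x hx => ?_⟩
  have hf : Continuous fun s => P s - Q s := hP.sub hQ
  set φ : ℝ → ℝ := fun r => ∫ s in (0 : ℝ)..r, ‖P s - Q s‖ with hφ
  have hφc : Continuous φ := intervalIntegral.continuous_primitive
    (fun a b => hf.norm.intervalIntegrable a b) 0
  have hφx : φ x = ∫ s in x₀..x, ‖P s - Q s‖ := by
    simp only [hφ]
    rw [← intervalIntegral.integral_add_adjacent_intervals (b := x₀)
      (hf.norm.intervalIntegrable _ _) (hf.norm.intervalIntegrable _ _), heq, zero_add]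
  have hφ0 : 0 ≤ φ x := intervalIntegral.integral_nonneg x.2.1 fun _ _ => norm_nonneg _
  have hφz : ∀ a ∈ Icc 0 x₀, φ a = 0 := fun a ha => by
    exact le_antisymm ((integral_norm_mono hf le_rfl ha.1 ha.2).trans_eq heq)
      (intervalIntegral.integral_nonneg ha.1 fun _ _ => norm_nonneg _)
  have hI : ∀ a b, IntervalIntegrable φ volume a b := fun a b => hφc.intervalIntegrable a b
  have hint : ∫ ξ in (0 : ℝ)..x, φ (x - ξ) ≤ (x - x₀) * φ x := by
    rw [intervalIntegral.integral_comp_sub_left, sub_zero, sub_self]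
    calc _ = ∫ s in x₀..x, φ s := by
          rw [← intervalIntegral.integral_add_adjacent_intervals (hI 0 x₀) (hI x₀ x),
            intervalIntegral.integral_congr (a := 0) (b := x₀) (g := fun _ => 0) fun s hs => by
              rw [uIcc_of_le hx₀.1] at hs; exact hφz s hs]
          simp
      _ ≤ ∫ s in x₀..x, φ x := intervalIntegral.integral_mono_on hx (hI _ _)
          (continuous_const.intervalIntegrable _ _) fun s hs =>
            integral_norm_mono hf le_rfl (hx₀.1.trans hs.1) hs.2
      _ = _ := by simp
  have hc := continuous_evenExt hΛ G
  rw [reflOp_apply, reflOp_apply, ← intervalIntegral.integral_sub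
    ((continuous_reflIntegrand_right hk.cont hc x).intervalIntegrable _ _)
    ((continuous_reflIntegrand_right hθ.cont hc x).intervalIntegrable _ _), ← hφx]
  calc _ ≤ ∫ ξ in (0 : ℝ)..x, ‖G‖ * (φ (x - ξ) + M * (x - x₀) * φ x) := by
        refine intervalIntegral.norm_integral_le_of_norm_le x.2.1
          (Eventually.of_forall fun ξ hξ => ?_) (Continuous.intervalIntegrable (by fun_prop) _ _)
        rw [← sub_mul, norm_mul, mul_comm]
        exact mul_le_mul (norm_evenExt_le hΛ G _)
          (hM x₀ x hx₀ ⟨hx, x.2.2⟩ heq ξ ⟨hξ.1.le, hξ.2⟩) (norm_nonneg _) (norm_nonneg _)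
    _ = ‖G‖ * ((∫ ξ in (0 : ℝ)..x, φ (x - ξ)) + x * (M * (x - x₀) * φ x)) := by
        rw [intervalIntegral.integral_const_mul, intervalIntegral.integral_add
          (Continuous.intervalIntegrable (by fun_prop) _ _)
          (continuous_const.intervalIntegrable _ _), intervalIntegral.integral_const, sub_zero,
          smul_eq_mul]
    _ ≤ ‖G‖ * ((x - x₀) * φ x + Λ * (M * (x - x₀) * φ x)) := by
        have := x.2.2
        have : 0 ≤ (x : ℝ) - x₀ := sub_nonneg.2 hx
        gcongr
    _ = _ := by ring

end IsGoursatKernel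

theorem eq_zero_of_weighted_norm_le_integral {f b : ℝ → ℂ} (hf : Continuous f) {Λ K : ℝ}
    (hΛ : 0 < Λ)
    (h : ∀ x₀ ∈ Icc 0 Λ, ∫ s in (0 : ℝ)..x₀, ‖f s‖ = 0 → ∀ x ∈ Icc x₀ Λ,
      ‖f x‖ * ‖b x‖ ≤ K * (x - x₀) * ∫ s in x₀..x, ‖f s‖)
    (hb : ∀ x₀ ∈ Ico 0 Λ, ∃ c, 0 < c ∧ ∀ᶠ x in 𝓝[>] x₀, c * (x - x₀) ≤ ‖b x‖) :
    ∀ x ∈ Icc 0 Λ, f x = 0 := by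
  set φ : ℝ → ℝ := fun r => ∫ s in (0 : ℝ)..r, ‖f s‖ with hφ
  have hφd : ∀ x, HasDerivAt φ ‖f x‖ x := fun x =>
    intervalIntegral.integral_hasDerivAt_right (hf.norm.intervalIntegrable _ _)
      (hf.norm.stronglyMeasurableAtFilter _ _) hf.norm.continuousAt
  have hφc : Continuous φ := continuous_iff_continuousAt.2 fun x => (hφd x).continuousAt
  have hsub : Icc 0 Λ ⊆ {x | φ x = 0} := by
    refine IsClosed.Icc_subset_of_forall_exists_gt
      ((isClosed_eq hφc continuous_const).inter isClosed_Icc) (by simp [hφ]) ?_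
    rintro x₀ ⟨hx₀, hx₀Λ⟩ y hy
    obtain ⟨c, hc, hev⟩ := hb x₀ hx₀Λ
    obtain ⟨ε, hε, hεb⟩ := mem_nhdsGT_iff_exists_Ioo_subset.1 hev
    set e := min ε (min Λ y) with he
    have hxe : x₀ < e := lt_min hε (lt_min hx₀Λ.2 hy)
    have hz := eq_zero_of_norm_le_integral hf hxe (M := K / c) fun x hx => by
      have h1 : c * (x - x₀) ≤ ‖b x‖ := hεb ⟨hx.1, hx.2.trans_le (min_le_left _ _)⟩
      have h2 := h x₀ ⟨hx₀Λ.1, hx₀Λ.2.le⟩ hx₀ x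
        ⟨hx.1.le, hx.2.le.trans ((min_le_right _ _).trans (min_le_left _ _))⟩
      have h3 : 0 < x - x₀ := sub_pos.2 hx.1
      rw [div_mul_eq_mul_div, le_div_iff₀ hc]
      have h4 := (mul_le_mul_of_nonneg_left h1 (norm_nonneg (f x))).trans h2
      refine le_of_mul_le_mul_right ?_ h3
      linarith
    refine ⟨e, ?_, hxe, (min_le_right _ _).trans (min_le_right _ _)⟩
    change φ e = 0
    simp only [hφ]
    rw [← intervalIntegral.integral_add_adjacent_intervals (b := x₀)
      (hf.norm.intervalIntegrable _ _) (hf.norm.intervalIntegrable _ _)]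
    rw [show ∫ s in (0 : ℝ)..x₀, ‖f s‖ = 0 from hx₀, zero_add,
      intervalIntegral.integral_congr (g := fun _ => 0) fun s hs => by
        rw [uIcc_of_le hxe.le] at hs
        simp [hz s hs]]
    simp
  have hIoo : EqOn f (fun _ => 0) (Ioo 0 Λ) := fun x hx => by
    have : φ =ᶠ[𝓝 x] fun _ => 0 := by
      filter_upwards [Icc_mem_nhds hx.1 hx.2] with s hs using hsub hs
    exact norm_eq_zero.1 ((hφd x).unique ((hasDerivAt_const x _).congr_of_eventuallyEq this))
  have := hIoo.closure hf continuous_const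
  rwa [closure_Ioo hΛ.ne] at this

/-- Uniqueness of the potential for the normalized equation `∂ₓ² u = P u + σ ∂ₜ u` with the Robin
condition `∂ₓ u = h u` at `0`, in integral form. -/
theorem potential_eq_of_mild {Λ T : ℝ} (hΛ : 0 < Λ) (hT : 0 < T) {σ : ℂ} (hσ : σ ≠ 0)
    {P Q : ℝ → ℂ} (hP : Continuous P) (hQ : Continuous Q) (h : ℂ)
    {u ut v vt : ℝ → C(Icc (0 : ℝ) Λ, ℂ)} (hut : Continuous ut) (hvt : Continuous vt)
    (hu : ∀ t ∈ Ioo 0 T, HasDerivAt u (ut t) t) (hv : ∀ t ∈ Ioo 0 T, HasDerivAt v (vt t) t)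
    (β : ℝ → ℂ)
    (hmu : ∀ t ∈ Ioo 0 T, ∀ x : Icc (0 : ℝ) Λ, u t x = β t * (1 + h * (x : ℝ)) +
      ∫ s in (0 : ℝ)..x, (((x : ℝ) - s : ℝ) : ℂ) *
        (P s * evenExt hΛ.le (u t) s + evenExt hΛ.le (σ • ut t) s))
    (hmv : ∀ t ∈ Ioo 0 T, ∀ x : Icc (0 : ℝ) Λ, v t x = β t * (1 + h * (x : ℝ)) +
      ∫ s in (0 : ℝ)..x, (((x : ℝ) - s : ℝ) : ℂ) *
        (Q s * evenExt hΛ.le (v t) s + evenExt hΛ.le (σ • vt t) s))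
    {b : ℝ → ℂ} (hbT : ∀ x : Icc (0 : ℝ) Λ, P x * b x + σ * ut T x = Q x * b x + σ * vt T x)
    (hb : ∀ x₀ ∈ Ico 0 Λ, ∃ c, 0 < c ∧ ∀ᶠ x in 𝓝[>] x₀, c * (x - x₀) ≤ ‖b x‖) :
    ∀ x ∈ Icc 0 Λ, P x = Q x := by
  obtain ⟨κ, κη, κ₀, hκ⟩ := exists_isGoursatKernel hΛ.le hP h
  obtain ⟨θ, θη, θ₀, hθ⟩ := exists_isGoursatKernel hΛ.le hQ h
  obtain ⟨J, hJ₁, hJ₂⟩ := exists_inverse_reflOp hΛ.le hκ.cont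
  obtain ⟨I, hI₁, hI₂⟩ := exists_inverse_reflOp hΛ.le hθ.cont
  have hUC := deriv_eq_zero_of_zero_cauchy_data hΛ hT hσ
    (Z := fun t => J (u t) - I (v t)) (Zt := fun t => J (ut t) - I (vt t)) (by fun_prop)
    (fun t ht => by
      have h1 := (J.restrictScalars ℝ).hasFDerivAt.comp_hasDerivAt t (hu t ht)
      have h2 := (I.restrictScalars ℝ).hasFDerivAt.comp_hasDerivAt t (hv t ht)
      exact h1.sub h2) fun t ht x => by
    have h1 := hκ.inverse_apply_of_mild hP hΛ hJ₁ hJ₂ (hmu t ht) x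
    have h2 := hθ.inverse_apply_of_mild hQ hΛ hI₁ hI₂ (hmv t ht) x
    have c1 := continuous_evenExt hΛ.le (J (σ • ut t))
    have c2 := continuous_evenExt hΛ.le (I (σ • vt t))
    rw [ContinuousMap.sub_apply, h1, h2, add_sub_add_left_eq_sub, ← intervalIntegral.integral_sub
      (Continuous.intervalIntegrable (by fun_prop) _ _)
      (Continuous.intervalIntegrable (by fun_prop) _ _), ← intervalIntegral.integral_const_mul]
    congr 1; ext s
    simp only [evenExt, map_smul, ContinuousMap.smul_apply, ContinuousMap.sub_apply, smul_eq_mul]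
    ring
  rw [sub_eq_zero] at hUC
  obtain ⟨M, hM0, hM⟩ := hκ.norm_reflOp_sub_le hΛ.le hP hθ hQ
  have hz := eq_zero_of_weighted_norm_le_integral (f := fun x => P x - Q x) (b := b) (hP.sub hQ)
    (K := ‖σ‖ * ‖J (ut T)‖ * M) hΛ (fun x₀ hx₀ hφ x hx => by
      have h1 := hM x₀ hx₀ hφ (J (ut T)) ⟨x, hx₀.1.trans hx.1, hx.2⟩ hx.1
      have h2 := congrArg (fun w => w ⟨x, hx₀.1.trans hx.1, hx.2⟩) (hJ₁ (ut T))
      have h3 := congrArg (fun w => w ⟨x, hx₀.1.trans hx.1, hx.2⟩) (hI₁ (vt T))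
      have h4 := hbT ⟨x, hx₀.1.trans hx.1, hx.2⟩
      rw [← hUC] at h3
      simp only [ContinuousMap.add_apply] at h2 h3 h4
      rw [← h2, ← h3] at h4
      have h5 : (P x - Q x) * b x = -(σ * (reflOp hΛ.le κ hκ.cont (J (ut T))
          ⟨x, hx₀.1.trans hx.1, hx.2⟩ - reflOp hΛ.le θ hθ.cont (J (ut T))
          ⟨x, hx₀.1.trans hx.1, hx.2⟩)) := by linear_combination h4
      rw [← norm_mul, h5, norm_neg, norm_mul]
      refine (mul_le_mul_of_nonneg_left h1 (norm_nonneg σ)).trans_eq ?_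
      ring) hb
  exact fun x hx => sub_eq_zero.1 (hz x hx)

theorem taylor_integral_of_hasDerivAt_Ioo {Λ : ℝ} {w w₁ w₂ : ℝ → ℂ}
    (hw : ∀ x ∈ Ioo 0 Λ, HasDerivAt w (w₁ x) x) (hw₁ : ∀ x ∈ Ioo 0 Λ, HasDerivAt w₁ (w₂ x) x)
    (cw : ContinuousOn w (Icc 0 Λ)) (cw₁ : ContinuousOn w₁ (Icc 0 Λ))
    (cw₂ : ContinuousOn w₂ (Icc 0 Λ)) {x : ℝ} (hx : x ∈ Icc 0 Λ) :
    w x = w 0 + x * w₁ 0 + ∫ s in (0 : ℝ)..x, ((x - s : ℝ) : ℂ) * w₂ s := by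
  have hsub : Icc 0 x ⊆ Icc 0 Λ := Icc_subset_Icc_right hx.2
  have cl : Continuous fun s : ℝ => ((x - s : ℝ) : ℂ) := by fun_prop
  have := intervalIntegral.integral_eq_sub_of_hasDerivAt_of_le hx.1
    (f := fun s => w s + ((x - s : ℝ) : ℂ) * w₁ s) (f' := fun s => ((x - s : ℝ) : ℂ) * w₂ s)
    ((cw.mono hsub).add (cl.continuousOn.mul (cw₁.mono hsub))) (fun s hs => by
      have hs' : s ∈ Ioo 0 Λ := ⟨hs.1, hs.2.trans_le hx.2⟩
      have h1 : HasDerivAt (fun s : ℝ => ((x - s : ℝ) : ℂ)) ((-1 : ℝ) : ℂ) s :=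
        ((hasDerivAt_id s).const_sub x).ofReal_comp
      refine ((hw s hs').add (h1.mul (hw₁ s hs'))).congr_deriv ?_
      push_cast; ring)
    ((cl.continuousOn.mul (cw₂.mono hsub)).intervalIntegrable_of_Icc hx.1)
  rw [this]
  simp

theorem exists_continuousMap_curve {K : Type*} [TopologicalSpace K] [CompactSpace K] {T : ℝ}
    (hT : 0 ≤ T) {f ft : ℝ → K → ℂ}
    (hf : ∀ t ∈ Icc 0 T, ∀ k, HasDerivWithinAt (fun s => f s k) (ft t k) (Icc 0 T) t)
    (cf : Continuous (f 0)) (cft : Continuous fun z : Icc 0 T × K => ft z.1 z.2) :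
    ∃ U V : ℝ → C(K, ℂ), Continuous V ∧ (∀ t, HasDerivAt U (V t) t) ∧
      ∀ t ∈ Icc 0 T, ∀ k, U t k = f t k ∧ V t k = ft t k := by
  have cV : Continuous (fun z : ℝ × K => ft (projIcc 0 T hT z.1) z.2) :=
    cft.comp (f := fun z : ℝ × K => (projIcc 0 T hT z.1, z.2)) (by fun_prop)
  set V : ℝ → C(K, ℂ) := ⇑(ContinuousMap.curry ⟨_, cV⟩) with hV
  have hVc : Continuous V := (ContinuousMap.curry ⟨_, cV⟩).continuous
  have hVt : ∀ t ∈ Icc 0 T, ∀ k, V t k = ft t k := fun t ht k => by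
    change ft (projIcc 0 T hT t) k = _
    rw [projIcc_of_mem hT ht]
  refine ⟨fun t => ⟨f 0, cf⟩ + ∫ s in (0 : ℝ)..t, V s, V, hVc, fun t =>
    (intervalIntegral.integral_hasDerivAt_right (hVc.intervalIntegrable _ _)
      (hVc.stronglyMeasurableAtFilter _ _) hVc.continuousAt).const_add _, fun t ht k =>
    ⟨?_, hVt t ht k⟩⟩
  have h1 : (∫ s in (0 : ℝ)..t, V s) k = ∫ s in (0 : ℝ)..t, V s k :=
    ((ContinuousMap.evalCLM ℝ k).intervalIntegral_comp_comm (hVc.intervalIntegrable 0 t)).symm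
  have hsub : Icc 0 t ⊆ Icc 0 T := Icc_subset_Icc_right ht.2
  have h2 := intervalIntegral.integral_eq_sub_of_hasDerivAt_of_le ht.1
    (f := fun s => f s k) (f' := fun s => V s k)
    (fun s hs => ((hf s (hsub hs) k).continuousWithinAt.mono hsub)) (fun s hs => by
      have hs' : s ∈ Icc 0 T := hsub (Ioo_subset_Icc_self hs)
      rw [hVt s hs' k]
      exact (hf s hs' k).hasDerivAt (Icc_mem_nhds hs.1 (hs.2.trans_le ht.2)))
    (Continuous.intervalIntegrable (by fun_prop) _ _)
  rw [ContinuousMap.add_apply, h1, h2]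
  simp

theorem exists_flow {r : ℝ → ℝ} (hr : Continuous r) (hr0 : ∀ x, 0 < r x) {M : ℝ}
    (hM : ∀ x, r x ≤ M) :
    ∃ X : ℝ → ℝ, X 0 = 0 ∧ StrictMono X ∧ Function.Surjective X ∧
      ∀ y, HasDerivAt X (r (X y)) y := by
  have hM0 : 0 < M := (hr0 0).trans_le (hM 0)
  have hri : Continuous fun x => (r x)⁻¹ := hr.inv₀ fun x => (hr0 x).ne'
  set S : ℝ → ℝ := fun x => ∫ s in (0 : ℝ)..x, (r s)⁻¹ with hS
  have hSd : ∀ x, HasDerivAt S (r x)⁻¹ x := fun x =>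
    intervalIntegral.integral_hasDerivAt_right (hri.intervalIntegrable _ _)
      (hri.stronglyMeasurableAtFilter _ _) hri.continuousAt
  have hSc : Continuous S := continuous_iff_continuousAt.2 fun x => (hSd x).continuousAt
  have hmono : StrictMono S := strictMono_of_deriv_pos fun x => by
    rw [(hSd x).deriv]; exact inv_pos.2 (hr0 x)
  have hlin : Monotone fun x => S x - M⁻¹ * x := by
    have hd : ∀ x, HasDerivAt (fun x => S x - M⁻¹ * x) ((r x)⁻¹ - M⁻¹) x := fun x => by
      exact ((hSd x).sub ((hasDerivAt_id x).const_mul M⁻¹)).congr_deriv (by simp)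
    refine monotone_of_deriv_nonneg (fun x => (hd x).differentiableAt) fun x => ?_
    rw [(hd x).deriv, sub_nonneg]
    exact inv_anti₀ (hr0 x) (hM x)
  have hS0 : S 0 = 0 := by simp [hS]
  have hsurj : Function.Surjective S := hSc.surjective
    (tendsto_atTop_mono' _ (by
      filter_upwards [eventually_ge_atTop 0] with x hx
      have := hlin hx
      simp only [hS0] at this
      simp only [id]
      linarith) (tendsto_id.const_mul_atTop (inv_pos.2 hM0)))
    (tendsto_atBot_mono' _ (by
      filter_upwards [eventually_le_atBot 0] with x hx
      have := hlin hx
      simp only [hS0] at this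
      simp only [id]
      linarith) (tendsto_id.const_mul_atBot (inv_pos.2 hM0)))
  set e := hmono.orderIsoOfSurjective S hsurj
  have he : ∀ x, e.symm (S x) = x := e.symm_apply_apply
  have he' : ∀ y, S (e.symm y) = y := e.apply_symm_apply
  refine ⟨e.symm, by simpa only [hS0] using he 0, e.symm.strictMono, e.symm.surjective, fun y => ?_⟩
  have := HasDerivAt.of_local_left_inverse e.symm.continuous.continuousAt (hSd (e.symm y))
    (inv_ne_zero (hr0 _).ne') (Eventually.of_forall he')
  rwa [inv_inv] at this

theorem liouville_integral_eq {Λ ℓ : ℝ} {α α₁ α₂ X : ℝ → ℝ} (hX0 : X 0 = 0) (hXΛ : X Λ = ℓ)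
    (hXm : StrictMono X) (hXd : ∀ y ∈ Icc 0 Λ, HasDerivAt X (α (X y) ^ 2) y)
    (hα : ∀ x ∈ Icc 0 ℓ, 0 < α x) (hα₁ : ∀ x ∈ Ioo 0 ℓ, HasDerivAt α (α₁ x) x)
    (hα₂ : ∀ x ∈ Ioo 0 ℓ, HasDerivAt α₁ (α₂ x) x) (cα : ContinuousOn α (Icc 0 ℓ))
    (cα₁ : ContinuousOn α₁ (Icc 0 ℓ)) (cα₂ : ContinuousOn α₂ (Icc 0 ℓ)) {f f₁ f₂ : ℝ → ℂ}
    (hf₁ : ∀ x ∈ Ioo 0 ℓ, HasDerivAt f (f₁ x) x) (hf₂ : ∀ x ∈ Ioo 0 ℓ, HasDerivAt f₁ (f₂ x) x)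
    (cf : ContinuousOn f (Icc 0 ℓ)) (cf₁ : ContinuousOn f₁ (Icc 0 ℓ))
    (cf₂ : ContinuousOn f₂ (Icc 0 ℓ)) (hf0 : f₁ 0 = 0) {y : ℝ} (hy : y ∈ Icc 0 Λ) :
    f (X y) / α (X y) = f 0 / α 0 * (1 + ((-(α₁ 0 * α 0) : ℝ) : ℂ) * y) +
      ∫ s in (0 : ℝ)..y, ((y - s : ℝ) : ℂ) *
        (α (X s) ^ 3 * f₂ (X s) - α (X s) ^ 2 * α₂ (X s) * f (X s)) := by
  have hmaps : MapsTo X (Icc 0 Λ) (Icc 0 ℓ) := fun s hs =>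
    ⟨hX0 ▸ hXm.monotone hs.1, hXΛ ▸ hXm.monotone hs.2⟩
  have hmaps' : MapsTo X (Ioo 0 Λ) (Ioo 0 ℓ) := fun s hs => ⟨hX0 ▸ hXm hs.1, hXΛ ▸ hXm hs.2⟩
  have cX : ContinuousOn X (Icc 0 Λ) := fun s hs => (hXd s hs).continuousAt.continuousWithinAt
  have toC : ∀ {g : ℝ → ℝ}, ContinuousOn g (Icc 0 ℓ) →
      ContinuousOn (fun s => ((g (X s) : ℝ) : ℂ)) (Icc 0 Λ) := fun hg =>
    Complex.continuous_ofReal.comp_continuousOn (hg.comp cX hmaps)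
  have cα' := toC cα
  have cα₁' := toC cα₁
  have cα₂' := toC cα₂
  have cf' := cf.comp cX hmaps
  have cf₁' := cf₁.comp cX hmaps
  have cf₂' := cf₂.comp cX hmaps
  have hα0 : ∀ s ∈ Icc 0 Λ, ((α (X s) : ℝ) : ℂ) ≠ 0 := fun s hs =>
    Complex.ofReal_ne_zero.2 (hα _ (hmaps hs)).ne'
  have hΛ : 0 ≤ Λ := hy.1.trans hy.2
  have hdC : ∀ {g : ℝ → ℂ} {g' : ℝ → ℂ}, (∀ x ∈ Ioo 0 ℓ, HasDerivAt g (g' x) x) →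
      ∀ s ∈ Ioo 0 Λ, HasDerivAt (fun s => g (X s)) (((α (X s) : ℝ) : ℂ) ^ 2 * g' (X s)) s := by
    intro g g' hg s hs
    refine ((hg _ (hmaps' hs)).scomp s (hXd s (Ioo_subset_Icc_self hs))).congr_deriv ?_
    rw [Complex.real_smul]; push_cast; rfl
  have key := taylor_integral_of_hasDerivAt_Ioo (Λ := Λ) (w := fun s => f (X s) / α (X s))
    (w₁ := fun s => α (X s) * f₁ (X s) - α₁ (X s) * f (X s))
    (w₂ := fun s => α (X s) ^ 3 * f₂ (X s) - α (X s) ^ 2 * α₂ (X s) * f (X s))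
    (fun s hs => by
      have h0 := hα0 s (Ioo_subset_Icc_self hs)
      refine ((hdC hf₁ s hs).div (hdC (fun x hx => (hα₁ x hx).ofReal_comp) s hs) h0).congr_deriv ?_
      field_simp)
    (fun s hs => by
      have d1 := hdC (fun x hx => (hα₁ x hx).ofReal_comp) s hs
      have d2 := hdC (fun x hx => (hα₂ x hx).ofReal_comp) s hs
      refine ((d1.mul (hdC hf₂ s hs)).sub (d2.mul (hdC hf₁ s hs))).congr_deriv ?_
      ring)
    (cf'.div cα' hα0) ((cα'.mul cf₁').sub (cα₁'.mul cf'))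
    (((cα'.pow 3).mul cf₂').sub (((cα'.pow 2).mul cα₂').mul cf')) hy
  have h00 : ((α 0 : ℝ) : ℂ) ≠ 0 := by simpa only [hX0] using hα0 0 ⟨le_rfl, hΛ⟩
  simp only [hX0, hf0] at key
  rw [key]
  congr 1
  push_cast
  field_simp
  ring

theorem exists_liouville_curve {T ℓ Λ : ℝ} (hT : 0 ≤ T) (hΛ : 0 ≤ Λ) {σ : ℂ} {p : ℝ → ℝ}
    {α α₁ α₂ X : ℝ → ℝ} (hX0 : X 0 = 0) (hXΛ : X Λ = ℓ)
    (hXm : StrictMono X) (hXd : ∀ y ∈ Icc 0 Λ, HasDerivAt X (α (X y) ^ 2) y)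
    (hα : ∀ x ∈ Icc 0 ℓ, 0 < α x) (hα₁ : ∀ x ∈ Ioo 0 ℓ, HasDerivAt α (α₁ x) x)
    (hα₂ : ∀ x ∈ Ioo 0 ℓ, HasDerivAt α₁ (α₂ x) x) (cα : ContinuousOn α (Icc 0 ℓ))
    (cα₁ : ContinuousOn α₁ (Icc 0 ℓ)) (cα₂ : ContinuousOn α₂ (Icc 0 ℓ))
    {u ut ux uxx : ℝ → ℝ → ℂ} (hu : IsC12 T ℓ u ut ux uxx)
    (hpde : ∀ t ∈ Icc 0 T, ∀ x ∈ Icc 0 ℓ,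
      σ * ut t x = ((α x ^ 4 : ℝ) : ℂ) * uxx t x - p x * u t x)
    (hneu : ∀ t ∈ Ioo 0 T, ux t 0 = 0) {P : ℝ → ℂ}
    (hP : ∀ s ∈ Icc 0 Λ, P s = ((p (X s) - α (X s) ^ 3 * α₂ (X s) : ℝ) : ℂ)) :
    ∃ U Ut : ℝ → C(Icc (0 : ℝ) Λ, ℂ), Continuous Ut ∧ (∀ t, HasDerivAt U (Ut t) t) ∧
      (∀ t ∈ Icc 0 T, ∀ y : Icc (0 : ℝ) Λ,
        U t y = u t (X y) / α (X y) ∧ Ut t y = ut t (X y) / α (X y)) ∧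
      ∀ t ∈ Ioo 0 T, ∀ y : Icc (0 : ℝ) Λ,
        U t y = u t 0 / α 0 * (1 + ((-(α₁ 0 * α 0) : ℝ) : ℂ) * (y : ℝ)) +
          ∫ s in (0 : ℝ)..y, (((y : ℝ) - s : ℝ) : ℂ) *
            (P s * evenExt hΛ (U t) s + evenExt hΛ (σ • Ut t) s) := by
  obtain ⟨hd, cu, cut, cux, cuxx⟩ := hu
  have hmaps : ∀ y : Icc (0 : ℝ) Λ, X y ∈ Icc 0 ℓ := fun y =>
    ⟨hX0.symm.trans_le (hXm.monotone y.2.1), (hXm.monotone y.2.2).trans_eq hXΛ⟩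
  have cX : Continuous fun y : Icc (0 : ℝ) Λ => X y :=
    continuous_iff_continuousAt.2 fun y =>
      ((hXd y y.2).continuousAt).comp continuous_subtype_val.continuousAt
  have cαX : Continuous fun y : Icc (0 : ℝ) Λ => ((α (X y) : ℝ) : ℂ) :=
    Complex.continuous_ofReal.comp (cα.comp_continuous cX hmaps)
  have hα0 : ∀ y : Icc (0 : ℝ) Λ, ((α (X y) : ℝ) : ℂ) ≠ 0 := fun y =>
    Complex.ofReal_ne_zero.2 (hα _ (hmaps y)).ne'
  obtain ⟨U, Ut, cUt, hU, hval⟩ := exists_continuousMap_curve hT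
    (f := fun t (y : Icc (0 : ℝ) Λ) => u t (X y) / α (X y))
    (ft := fun t (y : Icc (0 : ℝ) Λ) => ut t (X y) / α (X y))
    (fun t ht y => (hd t ht _ (hmaps y)).1.div_const _)
    ((cu.comp_continuous (f := fun y : Icc (0 : ℝ) Λ => ((0 : ℝ), X y))
      (continuous_const.prodMk cX)
      fun y => ⟨⟨le_rfl, hT⟩, hmaps y⟩).div cαX hα0)
    ((cut.comp_continuous (f := fun z : Icc 0 T × Icc (0 : ℝ) Λ => ((z.1 : ℝ), X z.2))
      ((continuous_subtype_val.comp continuous_fst).prodMk (cX.comp continuous_snd))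
      fun z => ⟨z.1.2, hmaps z.2⟩).div (cαX.comp continuous_snd) fun z => hα0 z.2)
  refine ⟨U, Ut, cUt, hU, hval, fun t ht y => ?_⟩
  have ht' := Ioo_subset_Icc_self ht
  have slice : ∀ {g : ℝ → ℝ → ℂ}, ContinuousOn (fun z : ℝ × ℝ => g z.1 z.2)
      (Icc 0 T ×ˢ Icc 0 ℓ) → ContinuousOn (g t) (Icc 0 ℓ) := fun hg =>
    hg.comp (f := fun x => (t, x)) (by fun_prop) fun x hx => ⟨ht', hx⟩
  rw [(hval t ht' y).1, liouville_integral_eq hX0 hXΛ hXm hXd hα hα₁ hα₂ cα cα₁ cα₂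
    (fun x hx => (hd t ht' x (Ioo_subset_Icc_self hx)).2.1.hasDerivAt (Icc_mem_nhds hx.1 hx.2))
    (fun x hx => (hd t ht' x (Ioo_subset_Icc_self hx)).2.2.hasDerivAt (Icc_mem_nhds hx.1 hx.2))
    (slice cu) (slice cux) (slice cuxx) (hneu t ht) y.2]
  congr 1
  refine intervalIntegral.integral_congr fun s hs => ?_
  rw [uIcc_of_le y.2.1] at hs
  have hs' : s ∈ Icc 0 Λ := ⟨hs.1, hs.2.trans y.2.2⟩
  have h0 := hα0 ⟨s, hs'⟩
  have h1 := hpde t ht' _ (hmaps ⟨s, hs'⟩)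
  have hv := hval t ht' ⟨s, hs'⟩
  rw [hP s hs', evenExt_of_mem hΛ _ hs', evenExt_of_mem hΛ _ hs', ContinuousMap.smul_apply,
    hv.1, hv.2, smul_eq_mul]
  push_cast at h1 ⊢
  field_simp
  linear_combination (((s : ℝ) : ℂ) - ((y : ℝ) : ℂ)) * h1

theorem exists_linear_lower_bound {f : ℝ → ℂ} {f' : ℂ} {x₀ : ℝ}
    (hf : HasDerivWithinAt f f' (Ioi x₀) x₀) (h : f x₀ = 0 → f' ≠ 0) :
    ∃ c, 0 < c ∧ ∀ᶠ x in 𝓝[>] x₀, c * (x - x₀) ≤ ‖f x‖ := by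
  by_cases h0 : f x₀ = 0
  · have hpos : 0 < ‖f'‖ := norm_pos_iff.2 (h h0)
    refine ⟨‖f'‖ / 2, half_pos hpos, ?_⟩
    filter_upwards [(hasDerivWithinAt_iff_isLittleO.1 hf).bound (half_pos hpos),
      self_mem_nhdsWithin] with x hx hx0
    have hx1 : 0 < x - x₀ := sub_pos.2 hx0
    rw [h0, sub_zero, Real.norm_of_nonneg hx1.le] at hx
    have h2 := norm_sub_norm_le ((x - x₀) • f') (f x)
    rw [norm_smul, Real.norm_of_nonneg hx1.le, norm_sub_rev] at h2
    linarith
  · have hpos : 0 < ‖f x₀‖ := norm_pos_iff.2 h0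
    refine ⟨‖f x₀‖ / 2, half_pos hpos, ?_⟩
    filter_upwards [hf.continuousWithinAt.norm.eventually_const_lt (half_lt_self hpos),
      Ioo_mem_nhdsGT (lt_add_one x₀)] with x hx hx0
    nlinarith [hx0.2]

theorem IsC12.pde_closed {T ℓ : ℝ} (hT : 0 < T) (hℓ : 0 < ℓ) {σ : ℂ} {p a : ℝ → ℝ}
    (cp : ContinuousOn p (Icc 0 ℓ)) (ca : ContinuousOn a (Icc 0 ℓ))
    {u ut ux uxx : ℝ → ℝ → ℂ} (hu : IsC12 T ℓ u ut ux uxx)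
    (hpde : ∀ t ∈ Ioo (0:ℝ) T, ∀ x ∈ Ioo (0:ℝ) ℓ, σ * ut t x = a x * uxx t x - p x * u t x) :
    ∀ t ∈ Icc (0:ℝ) T, ∀ x ∈ Icc (0:ℝ) ℓ, σ * ut t x = a x * uxx t x - p x * u t x := by
  obtain ⟨-, cu, cut, -, cuxx⟩ := hu
  have toC : ∀ {g : ℝ → ℝ}, ContinuousOn g (Icc 0 ℓ) →
      ContinuousOn (fun z : ℝ × ℝ => ((g z.2 : ℝ) : ℂ)) (Icc 0 T ×ˢ Icc 0 ℓ) := fun hg =>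
    Complex.continuous_ofReal.comp_continuousOn
      (hg.comp continuous_snd.continuousOn fun z hz => hz.2)
  have key := EqOn.of_subset_closure (s := Ioo (0 : ℝ) T ×ˢ Ioo (0 : ℝ) ℓ)
    (t := Icc (0 : ℝ) T ×ˢ Icc (0 : ℝ) ℓ) (f := fun z => σ * ut z.1 z.2)
    (g := fun z => a z.2 * uxx z.1 z.2 - p z.2 * u z.1 z.2)
    (fun z hz => hpde z.1 hz.1 z.2 hz.2) (continuousOn_const.mul cut)
    (((toC ca).mul cuxx).sub ((toC cp).mul cu))
    (prod_mono Ioo_subset_Icc_self Ioo_subset_Icc_self)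
    (by rw [closure_prod_eq, closure_Ioo hT.ne, closure_Ioo hℓ.ne])
  exact fun t ht x hx => key (x := (t, x)) ⟨ht, hx⟩

theorem IsC12.second_deriv_eq {T ℓ t : ℝ} (hℓ : 0 < ℓ) {u ut ux uxx v vt vx vxx : ℝ → ℝ → ℂ}
    (hu : IsC12 T ℓ u ut ux uxx) (hv : IsC12 T ℓ v vt vx vxx) (ht : t ∈ Icc 0 T)
    (huv : EqOn (u t) (v t) (Icc 0 ℓ)) : EqOn (uxx t) (vxx t) (Icc 0 ℓ) := by
  have hU := uniqueDiffOn_Icc hℓ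
  have h1 : EqOn (ux t) (vx t) (Icc 0 ℓ) := fun x hx =>
    (hU x hx).eq_deriv _ (hu.1 t ht x hx).2.1 ((hv.1 t ht x hx).2.1.congr huv (huv hx))
  exact fun x hx =>
    (hU x hx).eq_deriv _ (hu.1 t ht x hx).2.2 ((hv.1 t ht x hx).2.2.congr h1 (h1 hx))

end

open Filter Topology in
theorem stmt_2
    (T ℓ : ℝ) (hT : 0 < T) (hℓ : 0 < ℓ)
    (σ : ℂ) (hσ : σ ≠ 0)
    (p q a : ℝ → ℝ)
    (hp : ContDiffOn ℝ 1 p (Icc 0 ℓ)) (hq : ContDiffOn ℝ 1 q (Icc 0 ℓ))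
    (ha : ContDiffOn ℝ 2 a (Icc 0 ℓ)) (hapos : ∀ x ∈ Icc (0:ℝ) ℓ, 0 < a x)
    (b : ℝ → ℂ) (hb : ContDiffOn ℝ 3 b (Icc 0 ℓ))
    (hbfin : {x ∈ Icc (0:ℝ) ℓ | b x = 0}.Finite)
    (hbord : ∀ x ∈ Icc (0:ℝ) ℓ, b x = 0 → derivWithin b (Icc 0 ℓ) x ≠ 0)
    (u ut ux uxx v vt vx vxx : ℝ → ℝ → ℂ)
    (hu : IsC12 T ℓ u ut ux uxx) (hv : IsC12 T ℓ v vt vx vxx)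
    (hupde : ∀ t ∈ Ioo (0:ℝ) T, ∀ x ∈ Ioo (0:ℝ) ℓ,
      σ * ut t x = a x * uxx t x - p x * u t x)
    (hvpde : ∀ t ∈ Ioo (0:ℝ) T, ∀ x ∈ Ioo (0:ℝ) ℓ,
      σ * vt t x = a x * vxx t x - q x * v t x)
    (hinit : ∀ x ∈ Ioo (0:ℝ) ℓ, u T x = b x ∧ v T x = b x)
    (hdir : ∀ t ∈ Ioo (0:ℝ) T, u t 0 = v t 0)
    (hneu : ∀ t ∈ Ioo (0:ℝ) T, ux t 0 = 0 ∧ vx t 0 = 0)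
    : ∀ x ∈ Icc (0:ℝ) ℓ, p x = q x := by
  have hTT : T ∈ Icc 0 T := ⟨hT.le, le_rfl⟩
  have hU := uniqueDiffOn_Icc hℓ
  -- the fourth root of the diffusion coefficient and its derivatives
  set α : ℝ → ℝ := fun x => √(√(a x)) with hα_def
  have hα4 : ∀ x ∈ Icc 0 ℓ, a x = α x ^ 4 := fun x hx => by
    rw [show α x ^ 4 = (√(√(a x)) ^ 2) ^ 2 by rw [← pow_mul], Real.sq_sqrt (Real.sqrt_nonneg _),
      Real.sq_sqrt (hapos x hx).le]
  have hαpos : ∀ x ∈ Icc 0 ℓ, 0 < α x := fun x hx => Real.sqrt_pos.2 (Real.sqrt_pos.2 (hapos x hx))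
  have hαC : ContDiffOn ℝ 2 α (Icc 0 ℓ) :=
    (ha.sqrt fun x hx => (hapos x hx).ne').sqrt fun x hx => (Real.sqrt_pos.2 (hapos x hx)).ne'
  set α₁ := derivWithin α (Icc 0 ℓ)
  set α₂ := derivWithin α₁ (Icc 0 ℓ)
  have hα₁C : ContDiffOn ℝ 1 α₁ (Icc 0 ℓ) := hαC.derivWithin hU (by norm_num)
  have cα := hαC.continuousOn
  have cα₁ := hα₁C.continuousOn
  have cα₂ : ContinuousOn α₂ (Icc 0 ℓ) := hα₁C.continuousOn_derivWithin hU le_rfl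
  have hα₁ : ∀ x ∈ Ioo 0 ℓ, HasDerivAt α (α₁ x) x := fun x hx =>
    ((hαC.differentiableOn (by norm_num)) x
      (Ioo_subset_Icc_self hx)).hasDerivWithinAt.hasDerivAt (Icc_mem_nhds hx.1 hx.2)
  have hα₂ : ∀ x ∈ Ioo 0 ℓ, HasDerivAt α₁ (α₂ x) x := fun x hx =>
    ((hα₁C.differentiableOn (by norm_num)) x
      (Ioo_subset_Icc_self hx)).hasDerivWithinAt.hasDerivAt (Icc_mem_nhds hx.1 hx.2)
  -- the Liouville variable
  obtain ⟨A, hA⟩ := isCompact_Icc.exists_bound_of_continuousOn cα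
  have hA' : ∀ x ∈ Icc 0 ℓ, α x ≤ A := fun x hx => (le_abs_self _).trans (hA x hx)
  have hA0 : 0 < A := (hαpos 0 ⟨le_rfl, hℓ.le⟩).trans_le (hA' 0 ⟨le_rfl, hℓ.le⟩)
  have cαp : Continuous fun x => α (projIcc 0 ℓ hℓ.le x) :=
    cα.comp_continuous (by fun_prop) fun x => (projIcc 0 ℓ hℓ.le x).2
  obtain ⟨X, hX0, hXm, hXs, hXd'⟩ := exists_flow (cαp.pow 2)
    (fun x => pow_pos (hαpos _ (projIcc 0 ℓ hℓ.le x).2) 2) (M := A ^ 2) fun x =>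
      pow_le_pow_left₀ (hαpos _ (projIcc 0 ℓ hℓ.le x).2).le (hA' _ (projIcc 0 ℓ hℓ.le x).2) 2
  obtain ⟨Λ, hXΛ⟩ := hXs ℓ
  have hΛ : 0 < Λ := hXm.lt_iff_lt.1 (by rwa [hX0, hXΛ])
  have hmaps : MapsTo X (Icc 0 Λ) (Icc 0 ℓ) := fun s hs =>
    ⟨hX0.symm.trans_le (hXm.monotone hs.1), (hXm.monotone hs.2).trans_eq hXΛ⟩
  have hXd : ∀ y ∈ Icc 0 Λ, HasDerivAt X (α (X y) ^ 2) y := fun y hy => by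
    have : HasDerivAt X (α (projIcc 0 ℓ hℓ.le (X y)) ^ 2) y := hXd' y
    rwa [projIcc_of_mem hℓ.le (hmaps hy)] at this
  have cX : Continuous X := continuous_iff_continuousAt.2 fun y => (hXd' y).continuousAt
  -- the transformed potentials
  have hpot : ∀ r : ℝ → ℝ, ContinuousOn r (Icc 0 ℓ) → ∃ R : ℝ → ℂ, Continuous R ∧
      ∀ s ∈ Icc 0 Λ, R s = ((r (X s) - α (X s) ^ 3 * α₂ (X s) : ℝ) : ℂ) := by
    intro r hr
    have c := hr.sub ((cα.pow 3).mul cα₂)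
    refine ⟨fun s => ((r (X (projIcc 0 Λ hΛ.le s)) - α (X (projIcc 0 Λ hΛ.le s)) ^ 3 *
      α₂ (X (projIcc 0 Λ hΛ.le s)) : ℝ) : ℂ), Complex.continuous_ofReal.comp
      (c.comp_continuous (f := fun s => X (projIcc 0 Λ hΛ.le s))
        (cX.comp (continuous_subtype_val.comp continuous_projIcc))
        fun s => hmaps (projIcc 0 Λ hΛ.le s).2), fun s hs => ?_⟩
    simp only [projIcc_of_mem hΛ.le hs]
  obtain ⟨P, cP, hP⟩ := hpot p hp.continuousOn
  obtain ⟨Q, cQ, hQ⟩ := hpot q hq.continuousOn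
  have hupde' := hu.pde_closed hT hℓ hp.continuousOn ha.continuousOn hupde
  have hvpde' := hv.pde_closed hT hℓ hq.continuousOn ha.continuousOn hvpde
  obtain ⟨U, Ut, cUt, hUd, hUv, hmU⟩ := exists_liouville_curve hT.le hΛ.le hX0 hXΛ hXm hXd hαpos
    hα₁ hα₂ cα cα₁ cα₂ hu (fun t ht x hx => by rw [← hα4 x hx]; exact hupde' t ht x hx)
    (fun t ht => (hneu t ht).1) hP
  obtain ⟨V, Vt, cVt, hVd, hVv, hmV⟩ := exists_liouville_curve hT.le hΛ.le hX0 hXΛ hXm hXd hαpos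
    hα₁ hα₂ cα cα₁ cα₂ hv (fun t ht x hx => by rw [← hα4 x hx]; exact hvpde' t ht x hx)
    (fun t ht => (hneu t ht).2) hQ
  -- the final data
  have fin : ∀ {w wt wx wxx : ℝ → ℝ → ℂ}, IsC12 T ℓ w wt wx wxx → EqOn (w T) b (Ioo 0 ℓ) →
      EqOn (w T) b (Icc 0 ℓ) := fun {w _ _ _} hw h =>
    h.of_subset_closure (hw.2.1.comp (f := fun x => (T, x)) (by fun_prop) fun x hx => ⟨hTT, hx⟩)
      hb.continuousOn Ioo_subset_Icc_self (closure_Ioo hℓ.ne).ge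
  have huT := fin hu fun x hx => (hinit x hx).1
  have hvT := fin hv fun x hx => (hinit x hx).2
  have hxx := hu.second_deriv_eq hℓ hv hTT (huT.trans hvT.symm)
  have hPQ := potential_eq_of_mild hΛ hT hσ cP cQ _ cUt cVt (fun t _ => hUd t) (fun t _ => hVd t)
    (fun t => u t 0 / α 0) hmU (fun t ht y => by
      have := hmV t ht y
      rwa [← hdir t ht] at this)
    (b := fun s => b (X s) / α (X s)) (fun s => by
      have hs := hmaps s.2
      have h1 := hupde' T hTT _ hs
      have h2 := hvpde' T hTT _ hs
      rw [huT hs] at h1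
      rw [hvT hs, ← hxx hs] at h2
      rw [hP s s.2, hQ s s.2, (hUv T hTT s).2, (hVv T hTT s).2]
      have h0 : ((α (X s) : ℝ) : ℂ) ≠ 0 := Complex.ofReal_ne_zero.2 (hαpos _ hs).ne'
      push_cast
      field_simp
      linear_combination h1 - h2)
    fun s₀ hs₀ => by
      have hs₀' : s₀ ∈ Icc 0 Λ := Ico_subset_Icc_self hs₀
      have hbd : HasDerivWithinAt b (derivWithin b (Icc 0 ℓ) (X s₀)) (Icc 0 ℓ) (X s₀) :=
        (hb.differentiableOn (by norm_num) _ (hmaps hs₀')).hasDerivWithinAt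
      have hd := (hbd.scomp s₀ (hXd s₀ hs₀').hasDerivWithinAt hmaps).mono_of_mem_nhdsWithin
        (Icc_mem_nhdsGT_of_mem hs₀)
      obtain ⟨c, hc, hev⟩ := exists_linear_lower_bound hd fun h =>
        smul_ne_zero (pow_pos (hαpos _ (hmaps hs₀')) 2).ne' (hbord _ (hmaps hs₀') h)
      refine ⟨c / A, div_pos hc hA0, ?_⟩
      filter_upwards [hev, Icc_mem_nhdsGT_of_mem hs₀, self_mem_nhdsWithin] with s hs hs' hs0
      have hpos := hαpos _ (hmaps hs')
      rw [norm_div, Complex.norm_real, Real.norm_of_nonneg hpos.le, div_mul_eq_mul_div]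
      exact div_le_div₀ (norm_nonneg _) hs hpos (hA' _ (hmaps hs'))
  intro x hx
  obtain ⟨s, rfl⟩ := hXs x
  have hs : s ∈ Icc 0 Λ :=
    ⟨hXm.le_iff_le.1 (by rw [hX0]; exact hx.1), hXm.le_iff_le.1 (by rw [hXΛ]; exact hx.2)⟩
  have := hPQ s hs
  rw [hP s hs, hQ s hs, Complex.ofReal_inj] at this
  exact sub_left_injective this
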